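/- arXiv:2207.06727 — 3 statements merged into one kernel-verified Lean document; each statement's English description precedes it below -/
import Mathlib

section
/- For an m-dimensional subspace Z of an n-dimensional vector space V over F_q, with l a positive integer satisfying m + l ≤ n, the number x of l-dimensional subspaces W of V with Z ∩ W = {0} satisfies x ≥ [n choose l]_q − [m choose 1]_q · [n-1 choose l-1]_q. -/
open Module Set

/-- The Gaussian (q-)binomial coefficient, via the standard Pascal-type recurrence. -/
def gbinom (q : ℕ) : ℕ → ℕ → ℕ
  | _, 0 => 1
  | 0, _ + 1 => 0
  | n + 1, k + 1 => gbinom q n k + q ^ (k + 1) * gbinom q n (k + 1)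


lemma aux_alg (q : ℕ) : ∀ n k : ℕ, (gbinom q n k : ℤ) * ∏ i ∈ Finset.range k, ((q:ℤ)^k - (q:ℤ)^i)
    = ∏ i ∈ Finset.range k, ((q:ℤ)^n - (q:ℤ)^i) := by
  have key : ∀ n k : ℕ, ∏ i ∈ Finset.range (k+1), ((q:ℤ)^(n+1) - (q:ℤ)^i)
      = ((q:ℤ)^(n+1) - 1) * ((q:ℤ)^k * ∏ i ∈ Finset.range k, ((q:ℤ)^n - (q:ℤ)^i)) := by
    intro n k
    rw [Finset.prod_range_succ']
    have : ∏ i ∈ Finset.range k, ((q:ℤ)^(n+1) - (q:ℤ)^(i+1))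
        = (q:ℤ)^k * ∏ i ∈ Finset.range k, ((q:ℤ)^n - (q:ℤ)^i) := by
      conv_rhs => rw [← Finset.card_range k, ← Finset.prod_const, Finset.card_range,
        ← Finset.prod_mul_distrib]
      apply Finset.prod_congr rfl
      intros; ring
    rw [this]; ring
  intro n
  induction n with
  | zero =>
    intro k
    cases k with
    | zero => simp [gbinom]
    | succ k =>
      rw [Finset.prod_range_succ' (fun i => (q:ℤ)^0 - (q:ℤ)^i)]
      simp [gbinom]
  | succ n ih =>
    intro k
    cases k with
    | zero => simp [gbinom]
    | succ k =>
      have h1 := ih k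
      have h2 := ih (k+1)
      rw [Finset.prod_range_succ (fun i => (q:ℤ)^n - (q:ℤ)^i)] at h2
      rw [key n k]
      have e : (gbinom q (n+1) (k+1) : ℤ)
        = gbinom q n k + (q:ℤ)^(k+1) * gbinom q n (k+1) := by
        simp [gbinom]
      rw [e, add_mul, mul_assoc, h2, key k k, mul_left_comm, mul_left_comm (gbinom q n k : ℤ), h1]
      ring

lemma aux_card (q : ℕ) (K : Type*) [Field K] [Fintype K] (hK : Fintype.card K = q)
    (V : Type*) [AddCommGroup V] [Module K V] [FiniteDimensional K V] (l : ℕ)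
    (hl : l ≤ finrank K V) :
    Nat.card {W : Submodule K V // finrank K W = l} = gbinom q (finrank K V) l := by
  have : Finite V := Module.finite_of_finite K
  have : Fintype V := Fintype.ofFinite V
  have q1 : 1 < q := hK ▸ Fintype.one_lt_card
  let f : {s : Fin l → V // LinearIndependent K s} ≃
      Σ W : {W : Submodule K V // finrank K W = l},
        {s : Fin l → W.1 // LinearIndependent K s} :=
    { toFun := fun s => ⟨⟨Submodule.span K (Set.range s.1), by
          rw [finrank_span_eq_card s.2]; simp⟩,
          ⟨fun i => ⟨s.1 i, Submodule.subset_span ⟨i, rfl⟩⟩,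
            LinearIndependent.of_comp (Submodule.subtype _) s.2⟩⟩
      invFun := fun t => ⟨fun i => (t.2.1 i : V),
        t.2.2.map' (Submodule.subtype _) (Submodule.ker_subtype _)⟩
      left_inv := fun s => rfl
      right_inv := by
        rintro ⟨⟨W, hW⟩, ⟨s, hs⟩⟩
        have hspan : Submodule.span K (Set.range fun i => (s i : V)) = W := by
          apply Submodule.eq_of_le_of_finrank_eq
          · rw [Submodule.span_le]; rintro _ ⟨i, rfl⟩; exact (s i).2
          · have h := finrank_span_eq_card
              (hs.map' (Submodule.subtype _) (Submodule.ker_subtype _))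
            rw [Fintype.card_fin] at h
            exact h.trans hW.symm
        have gen : ∀ (U : Submodule K V) (hU : finrank K U = l) (_ : U = W)
            (hm : ∀ i, (s i : V) ∈ U)
            (hi : LinearIndependent K (fun i => (⟨(s i : V), hm i⟩ : U))),
            (⟨⟨U, hU⟩, ⟨fun i => ⟨(s i : V), hm i⟩, hi⟩⟩ :
              Σ W : {W : Submodule K V // finrank K W = l},
                {s : Fin l → W.1 // LinearIndependent K s}) = ⟨⟨W, hW⟩, ⟨s, hs⟩⟩ := by
          rintro U hU rfl hm hi
          rfl
        exact gen _ _ hspan _ _ }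
  have hc := Nat.card_congr f
  have hfib : ∀ W : {W : Submodule K V // finrank K W = l},
      Nat.card {s : Fin l → W.1 // LinearIndependent K s}
        = ∏ i : Fin l, (q ^ l - q ^ (i : ℕ)) := by
    intro W
    have := card_linearIndependent (K := K) (V := W.1) (k := l) W.2.ge
    rw [W.2, hK] at this
    exact this
  have : Fintype {W : Submodule K V // finrank K W = l} := Fintype.ofFinite _
  rw [Nat.card_sigma, Finset.sum_congr rfl (fun W _ => hfib W), card_linearIndependent hl,
    Finset.sum_const, hK, smul_eq_mul, Finset.card_univ, ← Nat.card_eq_fintype_card] at hc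
  have hz : ∀ n, l ≤ n → ((∏ i : Fin l, (q ^ n - q ^ (i : ℕ)) : ℕ) : ℤ)
      = ∏ i ∈ Finset.range l, ((q:ℤ)^n - (q:ℤ)^i) := by
    intro n hn
    rw [← Fin.prod_univ_eq_prod_range (fun i => (q:ℤ)^n - (q:ℤ)^i), Nat.cast_prod]
    apply Finset.prod_congr rfl
    intro i _
    rw [Nat.cast_sub (Nat.pow_le_pow_right (by omega) (by omega))]
    push_cast; rfl
  have h3 := aux_alg q (finrank K V) l
  rw [← hz _ hl, ← hz _ le_rfl, hc] at h3
  have hpos : 0 < ∏ i : Fin l, (q ^ l - q ^ (i : ℕ)) := by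
    apply Finset.prod_pos
    intro i _
    exact Nat.sub_pos_of_lt (Nat.pow_lt_pow_right q1 i.2)
  have h4 := Nat.eq_of_mul_eq_mul_right hpos (by exact_mod_cast h3)
  exact h4.symm

lemma aux_fib (q : ℕ) (K : Type*) [Field K] [Fintype K] (hK : Fintype.card K = q)
    (V : Type*) [AddCommGroup V] [Module K V] [FiniteDimensional K V] (l : ℕ)
    (h1 : 1 ≤ l) (hl : l ≤ finrank K V) (L : Submodule K V) (hL : finrank K L = 1) :
    {W : Submodule K V | finrank K W = l ∧ L ≤ W}.ncard
      ≤ gbinom q (finrank K V - 1) (l - 1) := by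
  have : Finite V := Module.finite_of_finite K
  have : Finite (V ⧸ L) := Module.finite_of_finite K
  have hq : finrank K (V ⧸ L) = finrank K V - 1 := by
    have := L.finrank_quotient_add_finrank; omega
  rw [← hq, ← aux_card q K hK (V ⧸ L) (l-1) (by omega)]
  rw [← Nat.card_coe_set_eq]
  apply Nat.card_le_card_of_injective
    (fun W : {W : Submodule K V | finrank K W = l ∧ L ≤ W} =>
      (⟨W.1.map L.mkQ, by
        have h := LinearMap.finrank_range_add_finrank_ker (L.mkQ.domRestrict W.1)
        rw [LinearMap.range_domRestrict, LinearMap.ker_domRestrict, Submodule.ker_mkQ, W.2.1] at h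
        have h' : finrank K (L.submoduleOf W.1) = 1 :=
          (Submodule.submoduleOfEquivOfLe W.2.2).finrank_eq.trans hL
        rw [Submodule.submoduleOf] at h'
        omega⟩ : {U : Submodule K (V ⧸ L) // finrank K U = l - 1}))
  rintro ⟨W, hW⟩ ⟨W', hW'⟩ h
  have h := congrArg (fun U => Submodule.comap L.mkQ U.1) h
  simp only [Submodule.comap_map_mkQ] at h
  rw [sup_eq_right.2 hW.2, sup_eq_right.2 hW'.2] at h
  exact Subtype.ext h

theorem stmt_1 (q n m l : ℕ) (K : Type*) [Field K] [Fintype K] (hK : Fintype.card K = q)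
    (V : Type*) [AddCommGroup V] [Module K V] [FiniteDimensional K V]
    (hV : finrank K V = n) (Z : Submodule K V) (hZ : finrank K Z = m)
    (hl : 1 ≤ l) (hml : m + l ≤ n) :
    (({W : Submodule K V | finrank K W = l ∧ Z ⊓ W = ⊥}.ncard : ℤ))
      ≥ (gbinom q n l : ℤ) - (gbinom q m 1 : ℤ) * (gbinom q (n - 1) (l - 1) : ℤ) := by
  classical
  have : Finite V := Module.finite_of_finite K
  have hlines : Nat.card {L : Submodule K Z // finrank K L = 1} ≤ gbinom q m 1 := by
    rcases Nat.eq_zero_or_pos m with h0 | h0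
    · have : IsEmpty {L : Submodule K Z // finrank K L = 1} := ⟨fun L => by
        have := L.1.finrank_le
        have := L.2
        omega⟩
      simp
    · rw [aux_card q K hK Z 1 (by omega), hZ]
  have htot : {W : Submodule K V | finrank K W = l}.ncard = gbinom q n l := by
    rw [← hV, ← aux_card q K hK V l (by omega), ← Nat.card_coe_set_eq]
    rfl
  have : Fintype {L : Submodule K Z // finrank K L = 1} := Fintype.ofFinite _
  have hsub : {W : Submodule K V | finrank K W = l} ⊆
      {W : Submodule K V | finrank K W = l ∧ Z ⊓ W = ⊥} ∪
      ⋃ L : {L : Submodule K Z // finrank K L = 1},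
        {W : Submodule K V | finrank K W = l ∧ L.1.map Z.subtype ≤ W} := by
    intro W hW
    by_cases hb : Z ⊓ W = ⊥
    · exact Or.inl ⟨hW, hb⟩
    · right
      obtain ⟨v, hv, hv0⟩ := Submodule.exists_mem_ne_zero_of_ne_bot hb
      rw [Set.mem_iUnion]
      refine ⟨⟨Submodule.span K {(⟨v, hv.1⟩ : Z)}, finrank_span_singleton ?_⟩, hW, ?_⟩
      · intro h; exact hv0 (congrArg Subtype.val h)
      · rw [Submodule.map_span, Submodule.span_le]
        rintro _ ⟨_, rfl, rfl⟩
        exact hv.2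
  have hU : (⋃ L : {L : Submodule K Z // finrank K L = 1},
        {W : Submodule K V | finrank K W = l ∧ L.1.map Z.subtype ≤ W}).ncard
        ≤ gbinom q m 1 * gbinom q (n-1) (l-1) := by
    refine (Set.ncard_iUnion_le_of_fintype _).trans ?_
    refine (Finset.sum_le_card_nsmul _ _ (gbinom q (n-1) (l-1)) ?_).trans ?_
    · intro L _
      rw [← hV]
      apply aux_fib q K hK V l hl (by omega)
      rw [Submodule.finrank_map_subtype_eq]; exact L.2
    · rw [smul_eq_mul, Finset.card_univ, ← Nat.card_eq_fintype_card]
      exact Nat.mul_le_mul_right _ hlines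
  have h1 := (Set.ncard_le_ncard hsub (Set.toFinite _)).trans (Set.ncard_union_le _ _)
  rw [htot] at h1
  have h2 : gbinom q n l ≤ {W : Submodule K V | finrank K W = l ∧ Z ⊓ W = ⊥}.ncard
    + gbinom q m 1 * gbinom q (n-1) (l-1) := by omega
  have h3 : (gbinom q n l : ℤ) ≤
      ({W : Submodule K V | finrank K W = l ∧ Z ⊓ W = ⊥}.ncard : ℤ)
        + (gbinom q m 1 : ℤ) * (gbinom q (n-1) (l-1) : ℤ) := by exact_mod_cast h2
  linarith
end

section
/- Suppose B = {B₁, B₂, …, B_r} ⊆ [V choose k+1] with r ≥ 2 and k ≥ 2, where dim V = n ≥ 2k+2. Let Γ(B) = {T ∈ [V choose k] : dim(T ∩ B_i) = 0 for some i}. Then |Γ(B)| ≥ q^{k(k+1)}·[n−k−1 choose k]_q + q^{(k−1)(k+1)}·[n−k−2 choose k−1]_q. -/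
open Module Set

theorem cnt_aux1 {K : Type*} [Field K] [Fintype K] {V : Type*} [AddCommGroup V] [Module K V]
    [FiniteDimensional K V] (W : Submodule K V) (a : V) (ha : a ∉ W) (k : ℕ) :
    {T : Submodule K (V ⧸ (K ∙ a)) | finrank K T = k ∧ T ⊓ W.map (K ∙ a).mkQ = ⊥}.ncard ≤
    {T : Submodule K V | finrank K T = k + 1 ∧ T ⊓ W = ⊥ ∧ a ∈ T}.ncard := by
  have : Finite V := Module.finite_of_finite K
  have : Finite (Submodule K V) := inferInstance
  have ha0 : a ≠ 0 := fun h => ha (h ▸ W.zero_mem)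
  have hmem : a ∈ K ∙ a := Submodule.mem_span_singleton_self a
  refine Set.ncard_le_ncard_of_injOn (fun T => T.comap (K ∙ a).mkQ) ?_ ?_ (Set.toFinite _)
  · rintro T ⟨hT, hTW⟩
    have haT : a ∈ T.comap (K ∙ a).mkQ := by
      rw [Submodule.mem_comap, Submodule.mkQ_apply, (Submodule.Quotient.mk_eq_zero _).2 hmem]
      exact T.zero_mem
    refine ⟨?_, ?_, haT⟩
    · have hle : (K ∙ a) ≤ T.comap (K ∙ a).mkQ := by
        rw [Submodule.span_singleton_le_iff_mem]
        exact haT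
      have h1 := (Submodule.quotientQuotientEquivQuotient (K ∙ a)
        (T.comap (K ∙ a).mkQ) hle).finrank_eq
      rw [Submodule.map_comap_eq_of_surjective (Submodule.mkQ_surjective _)] at h1
      have h2 := Submodule.finrank_quotient_add_finrank T
      have h3 := Submodule.finrank_quotient_add_finrank (T.comap (K ∙ a).mkQ)
      have h4 := Submodule.finrank_quotient_add_finrank (K ∙ a)
      rw [finrank_span_singleton ha0] at h4
      omega
    · rw [eq_bot_iff]
      rintro x ⟨hxT, hxW⟩
      have h0 : (K ∙ a).mkQ x ∈ T ⊓ W.map (K ∙ a).mkQ := ⟨hxT, Submodule.mem_map_of_mem hxW⟩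
      rw [hTW, Submodule.mem_bot, Submodule.mkQ_apply, Submodule.Quotient.mk_eq_zero,
        Submodule.mem_span_singleton] at h0
      obtain ⟨c, rfl⟩ := h0
      by_cases hc : c = 0
      · simp [hc]
      · exact absurd ((W.smul_mem_iff hc).1 hxW) ha
  · intro T _ T' _ h
    exact Submodule.comap_injective_of_surjective (Submodule.mkQ_surjective _) h

theorem finrank_map_line {K : Type*} [Field K] {V : Type*} [AddCommGroup V] [Module K V]
    [FiniteDimensional K V] (W : Submodule K V) (a : V) (ha : a ∉ W) :
    finrank K (W.map (K ∙ a).mkQ) = finrank K W := by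
  have hinj : Function.Injective ((K ∙ a).mkQ.comp W.subtype) := by
    rw [← LinearMap.ker_eq_bot, LinearMap.ker_eq_bot']
    rintro ⟨x, hx⟩ h0
    simp only [LinearMap.comp_apply, Submodule.subtype_apply, Submodule.mkQ_apply] at h0
    rw [Submodule.Quotient.mk_eq_zero, Submodule.mem_span_singleton] at h0
    obtain ⟨c, rfl⟩ := h0
    by_cases hc : c = 0
    · simp [hc]
    · exact absurd ((W.smul_mem_iff hc).1 hx) ha
  have := LinearMap.finrank_range_of_inj hinj
  rwa [LinearMap.range_comp, Submodule.range_subtype] at this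

theorem finrank_sup_line {K : Type*} [Field K] {V : Type*} [AddCommGroup V] [Module K V]
    [FiniteDimensional K V] (W : Submodule K V) (a : V) (ha : a ∉ W) :
    finrank K (W ⊔ (K ∙ a) : Submodule K V) = finrank K W + 1 := by
  have ha0 : a ≠ 0 := fun h => ha (h ▸ W.zero_mem)
  have h := Submodule.finrank_sup_add_finrank_inf_eq W (K ∙ a)
  have hb : W ⊓ (K ∙ a) = ⊥ := by
    rw [eq_bot_iff]
    rintro x ⟨hx, hx2⟩
    obtain ⟨c, rfl⟩ := Submodule.mem_span_singleton.1 hx2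
    by_cases hc : c = 0
    · simp [hc]
    · exact absurd ((W.smul_mem_iff hc).1 hx) ha
  rw [hb, finrank_bot, finrank_span_singleton ha0] at h
  omega

theorem finrank_quot_line {K : Type*} [Field K] {V : Type*} [AddCommGroup V] [Module K V]
    [FiniteDimensional K V] (a : V) (ha0 : a ≠ 0) :
    finrank K (V ⧸ (K ∙ a)) + 1 = finrank K V := by
  have := Submodule.finrank_quotient_add_finrank (K ∙ a)
  rwa [finrank_span_singleton ha0] at this

theorem cnt_lower (K : Type*) [Field K] [Fintype K] (m : ℕ) :
    ∀ (V : Type _) [AddCommGroup V] [Module K V] [FiniteDimensional K V]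
    (W : Submodule K V) (k : ℕ), finrank K V = finrank K W + m →
    Fintype.card K ^ (k * finrank K W) * gbinom (Fintype.card K) m k ≤
    {T : Submodule K V | finrank K T = k ∧ T ⊓ W = ⊥}.ncard := by
  induction m with
  | zero =>
    intro V _ _ _ W k h
    have : Finite V := Module.finite_of_finite K
    cases k with
    | zero =>
      have : 0 < {T : Submodule K V | finrank K T = 0 ∧ T ⊓ W = ⊥}.ncard :=
        (Set.ncard_pos (Set.toFinite _)).2 ⟨⊥, by simp⟩
      simpa [gbinom, Nat.one_le_iff_ne_zero, Nat.pos_iff_ne_zero] using this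
    | succ k => simp [gbinom]
  | succ m ih =>
    intro V _ _ _ W k h
    have : Finite V := Module.finite_of_finite K
    cases k with
    | zero =>
      have : 0 < {T : Submodule K V | finrank K T = 0 ∧ T ⊓ W = ⊥}.ncard :=
        (Set.ncard_pos (Set.toFinite _)).2 ⟨⊥, by simp⟩
      simpa [gbinom, Nat.one_le_iff_ne_zero, Nat.pos_iff_ne_zero] using this
    | succ k =>
      classical
      have hlt : W < ⊤ := by
        rw [lt_top_iff_ne_top]
        rintro rfl
        rw [finrank_top] at h
        omega
      obtain ⟨a, -, ha⟩ := SetLike.exists_of_lt hlt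
      set q := Fintype.card K with hq
      have h1 := ih V (W ⊔ (K ∙ a)) (k+1) (by rw [finrank_sup_line W a ha]; omega)
      rw [finrank_sup_line W a ha] at h1
      have hax : ∀ x : W, a + x ∉ W := fun x hx => ha ((W.add_mem_iff_left x.2).1 hx)
      let S : W → Set (Submodule K V) := fun x =>
        {T : Submodule K V | finrank K T = k + 1 ∧ T ⊓ W = ⊥ ∧ a + x ∈ T}
      have h2 : ∀ x : W, q ^ (k * finrank K W) * gbinom q m k ≤ (S x).ncard := by
        intro x
        refine le_trans ?_ (cnt_aux1 W (a + x) (hax x) k)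
        have h0 : a + (x:V) ≠ 0 := fun h => hax x (h ▸ W.zero_mem)
        have h3 := finrank_quot_line (K := K) (a + (x:V)) h0
        have h4 := finrank_map_line W _ (hax x)
        have := ih (V ⧸ (K ∙ (a + (x:V)))) (W.map (K ∙ (a + (x:V))).mkQ) k (by omega)
        rwa [h4] at this
      have : Fintype W := Fintype.ofFinite _
      have : Fintype (Submodule K V) := Fintype.ofFinite _
      let U : Finset (Submodule K V) := Finset.univ.biUnion (fun x : W => (S x).toFinset)
      have hU : q ^ finrank K W * (q ^ (k * finrank K W) * gbinom q m k) ≤ U.card := by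
        rw [Finset.card_biUnion]
        · rw [hq, ← Module.card_eq_pow_finrank (K := K) (V := W), ← smul_eq_mul, ← Finset.card_univ]
          refine Finset.card_nsmul_le_sum _ _ _ ?_
          intro x _
          rw [← Set.ncard_eq_toFinset_card']
          exact h2 x
        · intro x _ y _ hxy
          change Disjoint (S x).toFinset (S y).toFinset
          rw [Set.disjoint_toFinset, Set.disjoint_left]
          rintro T ⟨_, hT, hx⟩ ⟨_, _, hy⟩
          apply hxy
          have h5 : (x:V) - y ∈ T ⊓ W := by
            refine ⟨?_, W.sub_mem x.2 y.2⟩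
            have := T.sub_mem hx hy
            simpa using this
          rw [hT, Submodule.mem_bot, sub_eq_zero] at h5
          exact Subtype.ext h5
      have hdis : Disjoint {T : Submodule K V | finrank K T = k+1 ∧ T ⊓ (W ⊔ (K ∙ a)) = ⊥}
          (U : Set (Submodule K V)) := by
        rw [Set.disjoint_left]
        rintro T ⟨_, hT⟩ hTU
        simp only [U, Finset.coe_biUnion, Set.mem_iUnion, Set.coe_toFinset] at hTU
        obtain ⟨x, -, _, _, hx⟩ := hTU
        have h6 : a + (x:V) ∈ T ⊓ (W ⊔ (K ∙ a)) :=
          ⟨hx, Submodule.add_mem _ (Submodule.mem_sup_right (Submodule.mem_span_singleton_self a))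
            (Submodule.mem_sup_left x.2)⟩
        rw [hT, Submodule.mem_bot] at h6
        exact hax x (h6 ▸ W.zero_mem)
      have hsub : {T : Submodule K V | finrank K T = k+1 ∧ T ⊓ (W ⊔ (K ∙ a)) = ⊥} ∪
          (U : Set (Submodule K V)) ⊆ {T : Submodule K V | finrank K T = k+1 ∧ T ⊓ W = ⊥} := by
        rintro T (⟨h1, h2⟩ | hTU)
        · exact ⟨h1, eq_bot_iff.2 (h2 ▸ inf_le_inf_left T le_sup_left)⟩
        · simp only [U, Finset.coe_biUnion, Set.mem_iUnion, Set.coe_toFinset] at hTU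
          obtain ⟨x, -, h1, h2, hx⟩ := hTU
          exact ⟨h1, h2⟩
      have hle := Set.ncard_le_ncard hsub (Set.toFinite _)
      rw [Set.ncard_union_eq hdis (Set.toFinite _) (Set.toFinite _), Set.ncard_coe_finset] at hle
      refine le_trans (le_of_eq ?_) (le_trans (Nat.add_le_add h1 hU) hle)
      rw [gbinom]
      ring

theorem stmt_5 (q n k : ℕ) (K : Type*) [Field K] [Fintype K] (hK : Fintype.card K = q)
    (V : Type*) [AddCommGroup V] [Module K V] [FiniteDimensional K V]
    (hV : finrank K V = n) (hk : 2 ≤ k) (hn : 2 * k + 2 ≤ n)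
    (B : Set (Submodule K V)) (hB : ∀ b ∈ B, finrank K b = k + 1)
    (hr : 2 ≤ B.ncard) :
    {T : Submodule K V | finrank K T = k ∧ ∃ b ∈ B, T ⊓ b = ⊥}.ncard
      ≥ q ^ (k * (k + 1)) * gbinom q (n - k - 1) k
        + q ^ ((k - 1) * (k + 1)) * gbinom q (n - k - 2) (k - 1) := by
  subst hK
  have : Finite V := Module.finite_of_finite K
  obtain ⟨A, hA, C, hC, hAC⟩ := (Set.one_lt_ncard (Set.toFinite B)).1 hr
  have hA1 := hB A hA
  have hC1 := hB C hC
  have hnle : ¬ A ≤ C := fun h => hAC (Submodule.eq_of_le_of_finrank_eq h (by omega))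
  obtain ⟨a, haA, haC⟩ := SetLike.not_le_iff_exists.1 hnle
  have ha0 : a ≠ 0 := fun h => haC (h ▸ C.zero_mem)
  have h1 := cnt_lower K (n - k - 1) V A k (by omega)
  have h3 := finrank_quot_line (K := K) a ha0
  have h4 := finrank_map_line C a haC
  have h2 := (cnt_lower K (n - k - 2) (V ⧸ (K ∙ a)) (C.map (K ∙ a).mkQ) (k-1) (by omega)).trans
    (cnt_aux1 C a haC (k-1))
  rw [h4, hC1, Nat.sub_add_cancel (by omega)] at h2
  rw [hA1] at h1
  refine (Nat.add_le_add h1 h2).trans ?_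
  rw [← Set.ncard_union_eq _ (Set.toFinite _) (Set.toFinite _)]
  · refine Set.ncard_le_ncard ?_ (Set.toFinite _)
    rintro T (⟨hT, h⟩ | ⟨hT, h, _⟩)
    · exact ⟨hT, A, hA, h⟩
    · exact ⟨hT, C, hC, h⟩
  · rw [Set.disjoint_left]
    rintro T ⟨_, h⟩ ⟨_, _, h'⟩
    have : a ∈ T ⊓ A := ⟨h', haA⟩
    rw [h, Submodule.mem_bot] at this
    exact ha0 this
end

section
/- Let V be an n-dimensional vector space over F_q with 2 ≤ s = 2d < n, and let F ⊆ L(V) be s-union with F not contained in K[n,2d] = {F ≤ V : dim F ≤ d}. Then |F| ≤ ∑_{i=0}^{d} [n choose i]_q − q^{d(d+1)}·[n−d−1 choose d]_q + 1. Moreover for s ≤ n−2, equality holds if and only if F = ({F ≤ V : dim F ≤ d} \ {F ∈ [V choose d] : dim(F ∩ U) = 0}) ∪ {U} for some fixed (d+1)-dimensional subspace U of V. -/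
open Module Set

set_option linter.unusedSectionVars false

section aux
open Classical

variable {K V : Type*} [Field K] [AddCommGroup V] [Module K V] [FiniteDimensional K V]

/-- tuple independent modulo `P`. -/
def goodT (P : Submodule K V) {a : ℕ} (v : Fin a → V) : Prop :=
  finrank K ↥(P ⊔ Submodule.span K (Set.range v)) = finrank K P + a

lemma fr_sup_span_le (P : Submodule K V) {a : ℕ} (v : Fin a → V) :
    finrank K ↥(P ⊔ Submodule.span K (Set.range v)) ≤ finrank K P + a := by
  have h1 := Submodule.finrank_add_le_finrank_add_finrank P (Submodule.span K (Set.range v))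
  have h2 := finrank_range_le_card (R := K) v
  simp only [Set.finrank, Fintype.card_fin] at h2
  omega

lemma fr_sup_single_le (P : Submodule K V) (x : V) :
    finrank K ↥(P ⊔ Submodule.span K {x}) ≤ finrank K P + 1 := by
  have h1 := Submodule.finrank_add_le_finrank_add_finrank P (Submodule.span K {x})
  have h2 := finrank_span_le_card (R := K) ({x} : Set V)
  simp at h2
  omega

lemma fr_sup_single (P : Submodule K V) {x : V} (hx : x ∉ P) :
    finrank K ↥(P ⊔ Submodule.span K {x}) = finrank K P + 1 := by
  have h1 := fr_sup_single_le P x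
  have h2 : P < P ⊔ Submodule.span K {x} := by
    refine lt_of_le_of_ne le_sup_left fun h => hx ?_
    rw [h]
    exact Submodule.mem_sup_right (Submodule.mem_span_singleton_self x)
  have := Submodule.finrank_lt_finrank_of_lt h2
  omega

lemma fr_sup_single_iff (P : Submodule K V) {x : V} :
    finrank K ↥(P ⊔ Submodule.span K {x}) = finrank K P + 1 ↔ x ∉ P := by
  refine ⟨fun h hx => ?_, fr_sup_single P⟩
  rw [sup_eq_left.2 (by simpa using hx)] at h
  omega

lemma span_cons {a : ℕ} (x : V) (v : Fin a → V) :
    Submodule.span K (Set.range (Fin.cons x v : Fin (a+1) → V))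
      = Submodule.span K {x} ⊔ Submodule.span K (Set.range v) := by
  rw [Fin.range_cons, Submodule.span_insert]

lemma good_cons1 (P : Submodule K V) {a : ℕ} (x : V) (v : Fin a → V) :
    goodT P (Fin.cons x v : Fin (a+1) → V) ↔ x ∉ P ∧ goodT (P ⊔ Submodule.span K {x}) v := by
  unfold goodT
  rw [span_cons, ← sup_assoc, ← fr_sup_single_iff P]
  have h1 := fr_sup_single_le P x
  have h2 := fr_sup_span_le (P ⊔ Submodule.span K {x}) v
  omega

lemma good_cons2 (P : Submodule K V) {a : ℕ} (x : V) (v : Fin a → V) :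
    goodT P (Fin.cons x v : Fin (a+1) → V) ↔
      goodT P v ∧ x ∉ P ⊔ Submodule.span K (Set.range v) := by
  unfold goodT
  rw [span_cons, sup_comm (Submodule.span K {x}), ← sup_assoc, ← fr_sup_single_iff]
  have h1 := fr_sup_single_le (P ⊔ Submodule.span K (Set.range v)) x
  have h2 := fr_sup_span_le P v
  omega

lemma good_zero (P : Submodule K V) (v : Fin 0 → V) : goodT P v := by
  have : Set.range v = ∅ := Set.range_eq_empty v
  unfold goodT
  rw [this, Submodule.span_empty, sup_bot_eq, add_zero]

lemma sum_cons {M : Type*} [AddCommMonoid M] [Fintype V] {a : ℕ} (f : (Fin (a+1) → V) → M) :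
    ∑ v, f v = ∑ x : V, ∑ w : Fin a → V, f (Fin.cons x w) := by
  rw [← (Fin.consEquiv (fun _ => V)).sum_comp, Fintype.sum_prod_type]
  rfl

variable [Fintype K] [Fintype V]

lemma card_sub (P : Submodule K V) :
    ∑ x : V, (if x ∈ P then (1:ℤ) else 0) = (Fintype.card K : ℤ) ^ finrank K P := by
  have := Module.card_eq_pow_finrank (K := K) (V := P)
  rw [Finset.sum_boole, ← Fintype.card_subtype, ]
  exact_mod_cast this

lemma card_sdiff (R P : Submodule K V) :
    ∑ x : V, (if x ∈ R ∧ x ∉ P then (1:ℤ) else 0)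
      = (Fintype.card K : ℤ) ^ finrank K R - (Fintype.card K : ℤ) ^ finrank K ↥(R ⊓ P) := by
  rw [← card_sub, ← card_sub, ← Finset.sum_sub_distrib]
  refine Finset.sum_congr rfl fun x _ => ?_
  simp only [Submodule.mem_inf]
  by_cases h1 : x ∈ R <;> by_cases h2 : x ∈ P <;> simp [h1, h2]

lemma card_sdiff2 (R P Q : Submodule K V) (hP : P ≤ R) (hQ : Q ≤ R) :
    ∑ x : V, (if x ∈ R ∧ x ∉ P ∧ x ∉ Q then (1:ℤ) else 0)
      = (Fintype.card K : ℤ) ^ finrank K R - (Fintype.card K : ℤ) ^ finrank K P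
        - (Fintype.card K : ℤ) ^ finrank K Q + (Fintype.card K : ℤ) ^ finrank K ↥(P ⊓ Q) := by
  rw [← card_sub, ← card_sub, ← card_sub, ← card_sub, ← Finset.sum_sub_distrib,
    ← Finset.sum_sub_distrib, ← Finset.sum_add_distrib]
  refine Finset.sum_congr rfl fun x _ => ?_
  simp only [Submodule.mem_inf]
  have h3 := @hP x
  have h4 := @hQ x
  by_cases h1 : x ∈ P <;> by_cases h2 : x ∈ Q <;> by_cases h : x ∈ R <;> simp_all

lemma cntE (E : Submodule K V) (a : ℕ) : ∀ (P : Submodule K V),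
    ∑ v : Fin a → V, (if (∀ i, v i ∈ E) ∧ goodT P v then (1:ℤ) else 0)
      = ∏ i ∈ Finset.range a, ((Fintype.card K : ℤ) ^ finrank K E
          - (Fintype.card K : ℤ) ^ (finrank K ↥(E ⊓ P) + i)) := by
  induction a with
  | zero => intro P; simp [good_zero]
  | succ a ih =>
    intro P
    rw [sum_cons, Finset.prod_range_succ']
    have : ∀ x : V, ∑ w : Fin a → V, (if (∀ i, (Fin.cons x w : Fin (a+1) → V) i ∈ E) ∧
        goodT P (Fin.cons x w : Fin (a+1) → V) then (1:ℤ) else 0)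
        = (if x ∈ E ∧ x ∉ P then (1:ℤ) else 0) *
          ∏ i ∈ Finset.range a, ((Fintype.card K : ℤ) ^ finrank K E
          - (Fintype.card K : ℤ) ^ (finrank K ↥(E ⊓ P) + (i+1))) := by
      intro x
      simp only [good_cons1, Fin.forall_fin_succ, Fin.cons_zero, Fin.cons_succ]
      by_cases hx : x ∈ E ∧ x ∉ P
      · have h1 : E ⊓ (P ⊔ Submodule.span K {x}) = (E ⊓ P) ⊔ Submodule.span K {x} := by
          rw [inf_sup_assoc_of_le]
          simpa using hx.1
        have h2 := fr_sup_single (E ⊓ P) (x := x) (fun h => hx.2 h.2)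
        have := ih (P ⊔ Submodule.span K {x})
        rw [h1, h2] at this
        simp only [hx.1, hx.2, true_and, not_false_eq_true, if_true, one_mul, this, and_self]
        refine Finset.prod_congr rfl fun i _ => ?_
        rw [add_assoc, add_comm 1 i]
      · rw [if_neg hx, zero_mul]
        refine Finset.sum_eq_zero fun w _ => if_neg ?_
        tauto
    rw [Finset.sum_congr rfl fun x _ => this x, ← Finset.sum_mul, card_sdiff, mul_comm]
    simp

lemma cntT (a : ℕ) (P : Submodule K V) :
    ∑ v : Fin a → V, (if goodT P v then (1:ℤ) else 0)
      = ∏ i ∈ Finset.range a, ((Fintype.card K : ℤ) ^ finrank K V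
          - (Fintype.card K : ℤ) ^ (finrank K P + i)) := by
  have := cntE (⊤ : Submodule K V) a P
  rw [top_inf_eq] at this
  simpa using this

lemma card_sdiff2_le (j : ℕ) (R P Q : Submodule K V) (hP : P ≤ R) (hQ : Q ≤ R) (h : P ≠ Q)
    (hPj : finrank K P = j + 1) (hQj : finrank K Q = j + 1) :
    ∑ x : V, (if x ∈ R ∧ x ∉ P ∧ x ∉ Q then (1:ℤ) else 0)
      ≤ (Fintype.card K : ℤ) ^ finrank K R - 2 * (Fintype.card K : ℤ) ^ (j + 1)
        + (Fintype.card K : ℤ) ^ j := by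
  rw [card_sdiff2 R P Q hP hQ, hPj, hQj]
  have h1 : P ⊓ Q < P := by
    refine lt_of_le_of_ne inf_le_left fun h' => h ?_
    exact Submodule.eq_of_le_of_finrank_eq (inf_eq_left.1 h') (by omega)
  have h2 := Submodule.finrank_lt_finrank_of_lt h1
  have h3 : (Fintype.card K : ℤ) ^ finrank K ↥(P ⊓ Q) ≤ (Fintype.card K : ℤ) ^ j :=
    pow_le_pow_right₀ (by exact_mod_cast Fintype.card_pos) (by omega)
  linarith

lemma q_ge (K : Type*) [Field K] [Fintype K] : (2:ℤ) ≤ Fintype.card K := by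
  exact_mod_cast Fintype.one_lt_card (α := K)

lemma G_bound (a : ℕ) : ∀ (j : ℕ) (P Q : Submodule K V), P ≠ Q → finrank K P = j + 1 →
    finrank K Q = j + 1 → j + 1 + (a + 1) ≤ finrank K V →
    ∑ v : Fin (a+1) → V, (if goodT P v ∧ goodT Q v then (1:ℤ) else 0) ≤
      ((Fintype.card K : ℤ) ^ finrank K V - (Fintype.card K : ℤ) ^ (j + 1)
        - (Fintype.card K : ℤ) ^ (j + 1 + a) + (Fintype.card K : ℤ) ^ j) *
      ∏ i ∈ Finset.range a, ((Fintype.card K : ℤ) ^ finrank K V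
          - (Fintype.card K : ℤ) ^ (j + 2 + i)) := by
  have hq := q_ge K
  induction a with
  | zero =>
    intro j P Q h hP hQ hn
    rw [sum_cons]
    simp only [good_cons1, good_zero, and_true]
    have := card_sdiff2_le j ⊤ P Q le_top le_top h hP hQ
    simp at this
    simp
    linarith
  | succ a ih =>
    intro j P Q h hP hQ hn
    set q : ℤ := (Fintype.card K : ℤ) with hqdef
    set n := finrank K V with hndef
    set g : ℤ := (q ^ n - q ^ (j + 1 + 1) - q ^ (j + 1 + 1 + a) + q ^ (j + 1)) *
      ∏ i ∈ Finset.range a, (q ^ n - q ^ (j + 1 + 2 + i)) with hg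
    set N : ℤ := ∏ i ∈ Finset.range (a+1), (q ^ n - q ^ (j + 2 + i)) with hN
    have hNe : N = (q ^ n - q ^ (j + 2)) * ∏ i ∈ Finset.range a, (q ^ n - q ^ (j + 1 + 2 + i)) := by
      rw [hN, Finset.prod_range_succ', mul_comm]
      congr 1
      refine Finset.prod_congr rfl fun i _ => ?_
      congr 2
      omega
    have hpi : 0 ≤ ∏ i ∈ Finset.range a, (q ^ n - q ^ (j + 1 + 2 + i)) := by
      refine Finset.prod_nonneg fun i hi => ?_
      have := Finset.mem_range.1 hi
      have : q ^ (j + 1 + 2 + i) ≤ q ^ n := pow_le_pow_right₀ (by linarith) (by omega)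
      linarith
    have hpos : ∀ m, 0 < q ^ m := fun m => pow_pos (by linarith) m
    have hg0 : 0 ≤ g := by
      refine mul_nonneg ?_ hpi
      have h1 : q ^ (j + 1 + 1) ≤ q ^ (j + 1 + 1 + a) := pow_le_pow_right₀ (by linarith) (by omega)
      have h2 : q ^ (j + 1 + 1 + a + 1) ≤ q ^ n := pow_le_pow_right₀ (by linarith) (by omega)
      rw [pow_succ] at h2
      nlinarith [hpos (j+1), hpos (j + 1 + 1 + a)]
    have hgN : g ≤ N := by
      rw [hNe]
      refine mul_le_mul_of_nonneg_right ?_ hpi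
      have h1 : q ^ (j + 1) ≤ q ^ (j + 1 + 1 + a) := pow_le_pow_right₀ (by linarith) (by omega)
      have e : j + 2 = j + 1 + 1 := rfl
      rw [e]
      linarith
    rw [sum_cons]
    have key : ∀ x : V, ∑ w : Fin (a+1) → V, (if goodT P (Fin.cons x w : Fin (a+2) → V) ∧
        goodT Q (Fin.cons x w : Fin (a+2) → V) then (1:ℤ) else 0)
        ≤ (if x ∈ (⊤ : Submodule K V) ∧ x ∉ P ∧ x ∉ Q then (1:ℤ) else 0) * g +
          (if x ∈ P ⊔ Q ∧ x ∉ P ∧ x ∉ Q then (1:ℤ) else 0) * 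
          (if finrank K ↥(P ⊔ Q) = j + 2 then (N - g) else 0) := by
      intro x
      simp only [good_cons1]
      by_cases hx : x ∉ P ∧ x ∉ Q
      · have hPx := fr_sup_single P hx.1
        have hQx := fr_sup_single Q hx.2
        simp only [hx.1, hx.2, true_and, not_false_eq_true, and_true, Submodule.mem_top, if_true, one_mul]
        by_cases hE : P ⊔ Submodule.span K {x} = Q ⊔ Submodule.span K {x}
        · have hle : P ⊔ Q ≤ P ⊔ Submodule.span K {x} := sup_le le_sup_left (hE ▸ le_sup_left)
          have hlt : P < P ⊔ Q := by
            refine lt_of_le_of_ne le_sup_left fun h' => h ?_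
            have : Q ≤ P := by rw [h']; exact le_sup_right
            exact (Submodule.eq_of_le_of_finrank_eq this (by omega)).symm
          have h1 := Submodule.finrank_lt_finrank_of_lt hlt
          have h2 := Submodule.finrank_mono hle
          have h3 := Submodule.eq_of_le_of_finrank_le hle (by omega)
          have h4 : x ∈ P ⊔ Q := by
            rw [h3]; exact Submodule.mem_sup_right (Submodule.mem_span_singleton_self x)
          rw [← hE]
          simp only [and_self, h4, if_true, one_mul]
          rw [if_pos (by omega), cntT, hPx, hP]
          apply le_of_eq
          rw [← hqdef, ← hndef]
          rw [hN]; ring_nf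
        · have := ih (j+1) _ _ hE (by omega) (by omega) (by omega)
          refine this.trans ?_
          have : 0 ≤ (if x ∈ P ⊔ Q then (1:ℤ) else 0) * (if finrank K ↥(P ⊔ Q) = j + 2 then (N - g) else 0) := by
            refine mul_nonneg ?_ ?_ <;> split_ifs <;> linarith
          linarith
      · rw [if_neg (by tauto), if_neg (by tauto), Finset.sum_eq_zero]
        · simp
        · intro w _; rw [if_neg]; tauto
    refine (Finset.sum_le_sum fun x _ => key x).trans ?_
    rw [Finset.sum_add_distrib, ← Finset.sum_mul, ← Finset.sum_mul]
    have c1 := card_sdiff2_le j ⊤ P Q le_top le_top h hP hQ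
    have c2 := card_sdiff2_le j (P ⊔ Q) P Q le_sup_left le_sup_right h hP hQ
    rw [finrank_top] at c1
    have c3 : (∑ x : V, (if x ∈ P ⊔ Q ∧ x ∉ P ∧ x ∉ Q then (1:ℤ) else 0)) * 
          (if finrank K ↥(P ⊔ Q) = j + 2 then (N - g) else 0) ≤
          (q ^ (j+2) - 2 * q ^ (j+1) + q ^ j) * (N - g) := by
      split_ifs with h'
      · rw [h'] at c2
        exact mul_le_mul_of_nonneg_right c2 (by linarith)
      · rw [mul_zero]
        refine mul_nonneg ?_ (by linarith)
        have := hpos j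
        have : q ^ (j+2) = q * q * q ^ j := by ring
        have : q ^ (j+1) = q * q ^ j := by ring
        nlinarith [mul_nonneg (hpos j).le (sq_nonneg (q-1))]
    have c4 := mul_le_mul_of_nonneg_right c1 hg0
    refine (add_le_add c4 c3).trans (le_of_eq ?_)
    rw [← hqdef, ← hndef, hNe, hg]
    ring

end aux

section aux2
open Classical
variable {K V : Type*} [Field K] [AddCommGroup V] [Module K V] [FiniteDimensional K V]

lemma good_bot {a : ℕ} (v : Fin a → V) :
    goodT (⊥ : Submodule K V) v ↔ finrank K ↥(Submodule.span K (Set.range v)) = a := by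
  rw [goodT, bot_sup_eq, finrank_bot, zero_add]

lemma good_iff (P : Submodule K V) {a : ℕ} (v : Fin a → V) :
    goodT P v ↔ goodT (⊥ : Submodule K V) v ∧ Disjoint P (Submodule.span K (Set.range v)) := by
  rw [good_bot, goodT, disjoint_iff, ← Submodule.finrank_eq_zero (R := K)]
  have h1 := Submodule.finrank_sup_add_finrank_inf_eq P (Submodule.span K (Set.range v))
  have h2 := finrank_range_le_card (R := K) v
  simp only [Set.finrank, Fintype.card_fin] at h2
  omega

variable [Fintype K] [Fintype V] [Fintype (Submodule K V)]

lemma sum_sub (a : ℕ) (R : Submodule K V → Prop) :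
    ∑ v : Fin a → V, (if goodT (⊥ : Submodule K V) v ∧ R (Submodule.span K (Set.range v))
        then (1:ℤ) else 0)
      = ((Finset.univ.filter fun A : Submodule K V => finrank K A = a ∧ R A).card : ℤ)
        * ∏ i ∈ Finset.range a, ((Fintype.card K : ℤ) ^ a - (Fintype.card K : ℤ) ^ i) := by
  have h1 : ∀ v : Fin a → V, (if goodT (⊥ : Submodule K V) v ∧ R (Submodule.span K (Set.range v))
        then (1:ℤ) else 0) = ∑ A ∈ Finset.univ.filter fun A : Submodule K V => finrank K A = a ∧ R A,
          if (∀ i, v i ∈ A) ∧ goodT (⊥ : Submodule K V) v then (1:ℤ) else 0 := by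
    intro v
    have hA : ∀ A ∈ Finset.univ.filter (fun A : Submodule K V => finrank K A = a ∧ R A),
        ((∀ i, v i ∈ A) ∧ goodT (⊥ : Submodule K V) v) →
        A = Submodule.span K (Set.range v) := by
      intro A hA h
      rw [good_bot] at h
      have hA := (Finset.mem_filter.1 hA).2
      refine (Submodule.eq_of_le_of_finrank_eq ?_ (by omega)).symm
      rw [Submodule.span_le]
      rintro _ ⟨i, rfl⟩
      exact h.1 i
    split_ifs with h
    · symm
      rw [Finset.sum_eq_single (Submodule.span K (Set.range v))]
      · rw [if_pos]
        exact ⟨fun i => Submodule.subset_span ⟨i, rfl⟩, h.1⟩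
      · intro A hA' hne
        rw [if_neg]
        exact fun h' => hne (hA A hA' h')
      · intro h'
        exfalso; apply h'
        rw [Finset.mem_filter]
        exact ⟨Finset.mem_univ _, (good_bot v).1 h.1, h.2⟩
    · symm
      refine Finset.sum_eq_zero fun A hA' => if_neg fun h' => h ?_
      have := hA A hA' h'
      refine ⟨h'.2, this ▸ (Finset.mem_filter.1 hA').2.2⟩
  rw [Finset.sum_congr rfl fun v _ => h1 v, Finset.sum_comm]
  rw [Finset.sum_congr rfl (g := fun _ => ∏ i ∈ Finset.range a, ((Fintype.card K : ℤ) ^ a - (Fintype.card K : ℤ) ^ i))]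
  · simp
  · intro A hA
    rw [cntE, inf_bot_eq]
    simp [(Finset.mem_filter.1 hA).2.1]

lemma gamma_pos (q : ℤ) (hq : 2 ≤ q) (a : ℕ) :
    0 < ∏ i ∈ Finset.range a, (q ^ a - q ^ i) := by
  refine Finset.prod_pos fun i hi => ?_
  have := pow_lt_pow_right₀ (show 1 < q by linarith) (Finset.mem_range.1 hi)
  linarith

lemma prod_succ_shift (q : ℤ) (n k : ℕ) : ∏ i ∈ Finset.range (k+1), (q ^ (n+1) - q ^ i)
    = (q ^ (n+1) - 1) * q ^ k * ∏ i ∈ Finset.range k, (q ^ n - q ^ i) := by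
  rw [Finset.prod_range_succ']
  have : ∀ i, q ^ (n+1) - q ^ (i+1) = q * (q ^ n - q ^ i) := fun i => by ring
  simp only [this, Finset.prod_mul_distrib]
  simp
  ring

lemma gbinom_eq (q : ℕ) : ∀ (n k : ℕ),
    (gbinom q n k : ℤ) * ∏ i ∈ Finset.range k, ((q:ℤ) ^ k - (q:ℤ) ^ i)
      = ∏ i ∈ Finset.range k, ((q:ℤ) ^ n - (q:ℤ) ^ i) := by
  intro n
  induction n with
  | zero =>
    intro k
    cases k with
    | zero => simp [gbinom]
    | succ k =>
      symm
      simp only [gbinom, Nat.cast_zero, zero_mul]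
      exact Finset.prod_eq_zero (Finset.mem_range.2 (Nat.succ_pos k)) (by simp)
  | succ n ih =>
    intro k
    cases k with
    | zero => simp [gbinom]
    | succ k =>
      have h1 := ih k
      have h2 := ih (k+1)
      rw [Finset.prod_range_succ (fun i => (q:ℤ) ^ n - (q:ℤ) ^ i)] at h2
      rw [prod_succ_shift] at h2 ⊢
      rw [prod_succ_shift]
      simp only [gbinom, Nat.cast_add, Nat.cast_mul, Nat.cast_pow]
      rw [← h1] at h2 ⊢
      linear_combination (q:ℤ) ^ (k+1) * h2

lemma card_dim (a : ℕ) :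
    ((Finset.univ.filter fun A : Submodule K V => finrank K A = a).card : ℤ)
      = gbinom (Fintype.card K) (finrank K V) a := by
  have h1 := sum_sub (K := K) (V := V) a (fun _ => True)
  simp only [and_true] at h1
  rw [cntT] at h1
  have h2 := gbinom_eq (Fintype.card K) (finrank K V) a
  simp only [finrank_bot, zero_add] at h1
  rw [h1] at h2
  exact (mul_right_cancel₀ (gamma_pos _ (q_ge K) a).ne' h2).symm

/-- number of `a`-spaces disjoint from `P` -/
lemma card_disj' (a : ℕ) (P : Submodule K V) :
    ((Finset.univ.filter fun A : Submodule K V => finrank K A = a ∧ Disjoint P A).card : ℤ) 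
     * ∏ i ∈ Finset.range a, ((Fintype.card K : ℤ) ^ a - (Fintype.card K : ℤ) ^ i)
      = ∏ i ∈ Finset.range a, ((Fintype.card K : ℤ) ^ finrank K V
          - (Fintype.card K : ℤ) ^ (finrank K P + i)) := by
  rw [← sum_sub, ← cntT]
  simp only [← good_iff]

lemma card_disj (a : ℕ) (P : Submodule K V) :
    ((Finset.univ.filter fun A : Submodule K V => finrank K A = a ∧ Disjoint P A).card : ℤ) 
      = (Fintype.card K : ℤ) ^ (a * finrank K P) *
        gbinom (Fintype.card K) (finrank K V - finrank K P) a := by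
  refine mul_right_cancel₀ (gamma_pos _ (q_ge K) a).ne' ?_
  rw [card_disj', mul_assoc, gbinom_eq, mul_comm a, pow_mul]
  have : (((Fintype.card K : ℤ)) ^ finrank K P) ^ a = ∏ i ∈ Finset.range a, ((Fintype.card K : ℤ)) ^ finrank K P := by simp
  rw [this, ← Finset.prod_mul_distrib]
  refine Finset.prod_congr rfl fun i _ => ?_
  have := Submodule.finrank_le P
  rw [mul_sub, ← pow_add, ← pow_add, Nat.add_sub_cancel' this]

lemma codeg_bound (a j : ℕ) (P Q : Submodule K V) (h : P ≠ Q) (hP : finrank K P = j + 1)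
    (hQ : finrank K Q = j + 1) (hn : j + 1 + (a + 1) ≤ finrank K V) :
    ((Finset.univ.filter fun A : Submodule K V => finrank K A = a + 1 ∧ 
      (Disjoint P A ∧ Disjoint Q A)).card : ℤ) 
     * ∏ i ∈ Finset.range (a+1), ((Fintype.card K : ℤ) ^ (a+1) - (Fintype.card K : ℤ) ^ i)
      ≤ ((Fintype.card K : ℤ) ^ finrank K V - (Fintype.card K : ℤ) ^ (j + 1)
        - (Fintype.card K : ℤ) ^ (j + 1 + a) + (Fintype.card K : ℤ) ^ j) *
      ∏ i ∈ Finset.range a, ((Fintype.card K : ℤ) ^ finrank K V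
          - (Fintype.card K : ℤ) ^ (j + 2 + i)) := by
  refine le_trans (le_of_eq ?_) (G_bound a j P Q h hP hQ hn)
  have hs := sum_sub (K := K) (V := V) (a+1) (fun A => Disjoint P A ∧ Disjoint Q A)
  have e2 : ∑ v : Fin (a+1) → V, (if goodT P v ∧ goodT Q v then (1:ℤ) else 0) = 
      ∑ v : Fin (a+1) → V, (if goodT (⊥ : Submodule K V) v ∧ (fun A => Disjoint P A ∧ Disjoint Q A)
        (Submodule.span K (Set.range v)) then (1:ℤ) else 0) := by
    refine Finset.sum_congr rfl fun v _ => if_congr ?_ rfl rfl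
    rw [good_iff P, good_iff Q]
    tauto
  rw [e2]
  convert hs.symm

/-! rank argument -/

lemma core {ι : Type*} [Fintype ι] (β : ι → Submodule K V) (hβ : Function.Injective β)
    (j t e : ℕ) (hj : ∀ i, finrank K (β i) = j)
    (hint : ∀ i i', j ≤ finrank K ↥(β i ⊓ β i') + t) (hte : t ≤ e) (hen : e + j ≤ finrank K V)
    (c : ι → ℚ) (hc : ∀ v : Fin e → V, ∑ i, c i * (if goodT (β i) v then 1 else 0) = 0) :
    ∀ i, c i = 0 := by
  have hq := q_ge K
  have hq1 : (1:ℚ) < (Fintype.card K : ℚ) := by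
    have : (1:ℤ) < Fintype.card K := by linarith
    exact_mod_cast this
  -- step 1
  have step1 : ∀ a, a ≤ e → ∀ v : Fin a → V, 
      ∑ i, c i * (if goodT (β i) v then 1 else 0) = 0 := by
    intro a ha
    induction ha using Nat.decreasingInduction with
    | self => exact hc
    | of_succ a ha ih =>
      intro v
      have h1 : ∑ x : V, ∑ i, c i * (if goodT (β i) (Fin.cons x v : Fin (a+1) → V) then (1:ℚ) else 0) = 0 :=
        Finset.sum_eq_zero fun x _ => ih _
      rw [Finset.sum_comm] at h1
      have h2 : ∀ i, ∑ x : V, c i * (if goodT (β i) (Fin.cons x v : Fin (a+1) → V) then (1:ℚ) else 0)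
          = (c i * (if goodT (β i) v then 1 else 0)) * 
            ((Fintype.card K : ℚ) ^ finrank K V - (Fintype.card K : ℚ) ^ (j + a)) := by
        intro i
        simp only [good_cons2]
        by_cases hv : goodT (β i) v
        · have h3 := card_sdiff (⊤ : Submodule K V) (β i ⊔ Submodule.span K (Set.range v))
          rw [top_inf_eq, finrank_top] at h3
          have hv' := hv
          unfold goodT at hv'
          rw [hv', hj] at h3
          simp only [hv, true_and, if_true, mul_one, ← Finset.mul_sum]
          congr 1
          simp only [Submodule.mem_top, true_and] at h3
          exact_mod_cast h3
        · simp [hv]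
      rw [Finset.sum_congr rfl fun i _ => h2 i, ← Finset.sum_mul] at h1
      rcases mul_eq_zero.1 h1 with h | h
      · exact h
      · exfalso
        have := pow_lt_pow_right₀ hq1 (show j + a < finrank K V by omega)
        linarith
  intro i0
  -- step 2
  have step2 : ∀ a, a ≤ e → ∑ i, c i * ∏ s ∈ Finset.range a, ((Fintype.card K : ℚ) ^ j
      - (Fintype.card K : ℚ) ^ (finrank K ↥(β i0 ⊓ β i) + s)) = 0 := by
    intro a ha
    have h1 : ∑ v : Fin a → V, (if ∀ k, v k ∈ β i0 then (1:ℚ) else 0) * 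
        ∑ i, c i * (if goodT (β i) v then 1 else 0) = 0 :=
      Finset.sum_eq_zero fun v _ => by rw [step1 a ha v, mul_zero]
    simp only [Finset.mul_sum] at h1
    rw [Finset.sum_comm] at h1
    rw [← h1]
    refine Finset.sum_congr rfl fun i _ => ?_
    have h3 := cntE (β i0) a (β i)
    rw [hj] at h3
    have h4 : ∑ v : Fin a → V, (if (∀ k, v k ∈ β i0) ∧ goodT (β i) v then (1:ℚ) else 0)
      = ∏ s ∈ Finset.range a, ((Fintype.card K : ℚ) ^ j
          - (Fintype.card K : ℚ) ^ (finrank K ↥(β i0 ⊓ β i) + s)) := by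
      have := congrArg (Int.cast : ℤ → ℚ) h3
      push_cast at this
      exact this
    rw [← h4, Finset.mul_sum]
    refine Finset.sum_congr rfl fun v _ => ?_
    by_cases h5 : ∀ k, v k ∈ β i0 <;> by_cases h6 : goodT (β i) v <;> simp [h5, h6]
  have hle : ∀ i, finrank K ↥(β i0 ⊓ β i) ≤ j := fun i => 
    (Submodule.finrank_mono inf_le_left).trans (hj i0).le
  have step3 : ∀ l, l ≤ j → ∑ i ∈ Finset.univ.filter (fun i => finrank K ↥(β i0 ⊓ β i) = l), c i = 0 := by
    intro l
    induction l using Nat.strong_induction_on with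
    | _ l ih =>
      intro hl
      by_cases hlt : l + t < j
      · rw [Finset.sum_eq_zero]
        intro i hi
        have := (Finset.mem_filter.1 hi).2
        have := hint i0 i
        omega
      have h := step2 (j - l) (by omega)
      rw [← Finset.sum_fiberwise_of_maps_to (s := Finset.univ) (t := Finset.range (j+1))
        (g := fun i => finrank K ↥(β i0 ⊓ β i)) (fun i _ => Finset.mem_range.2 (by have := hle i; omega))] at h
      rw [Finset.sum_eq_single l] at h
      · rw [Finset.sum_congr rfl (g := fun i => c i * ∏ s ∈ Finset.range (j-l), ((Fintype.card K : ℚ) ^ j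
          - (Fintype.card K : ℚ) ^ (l + s)))] at h
        · rw [← Finset.sum_mul] at h
          rcases mul_eq_zero.1 h with h | h
          · exact h
          · exfalso
            obtain ⟨s, hs, h⟩ := Finset.prod_eq_zero_iff.1 h
            have := Finset.mem_range.1 hs
            have := pow_lt_pow_right₀ hq1 (show l + s < j by omega)
            linarith
        · intro i hi
          rw [(Finset.mem_filter.1 hi).2]
      · intro l' hl' hne
        have hl' := Finset.mem_range.1 hl'
        rw [Finset.sum_congr rfl (g := fun i => c i * ∏ s ∈ Finset.range (j-l), ((Fintype.card K : ℚ) ^ j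
          - (Fintype.card K : ℚ) ^ (l' + s)))]
        · rw [← Finset.sum_mul]
          rcases lt_or_gt_of_ne hne with h1 | h1
          · rw [ih l' h1 (by omega), zero_mul]
          · rw [Finset.prod_eq_zero (i := j - l') (Finset.mem_range.2 (by omega)), mul_zero]
            rw [Nat.add_sub_cancel' (by omega), sub_self]
        · intro i hi
          rw [(Finset.mem_filter.1 hi).2]
      · intro h'
        exfalso; apply h'; exact Finset.mem_range.2 (by omega)
  have h := step3 j le_rfl
  have h2 : (Finset.univ.filter (fun i => finrank K ↥(β i0 ⊓ β i) = j)) = {i0} := by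
    ext i
    simp only [Finset.mem_filter, Finset.mem_univ, true_and, Finset.mem_singleton]
    constructor
    · intro h
      apply hβ
      have e1 : β i0 ⊓ β i = β i0 := Submodule.eq_of_le_of_finrank_eq inf_le_left (by rw [h, hj])
      have e2 : β i0 ⊓ β i = β i := Submodule.eq_of_le_of_finrank_eq inf_le_right (by rw [h, hj])
      rw [← e2, e1]
    · rintro rfl; rw [inf_idem, hj]
  rwa [h2, Finset.sum_singleton] at h

lemma rank_bound (B : Finset (Submodule K V)) 
    (j t e : ℕ) (hj : ∀ P ∈ B, finrank K P = j)
    (hint : ∀ P ∈ B, ∀ Q ∈ B, j ≤ finrank K ↥(P ⊓ Q) + t) (hte : t ≤ e)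
    (hen : e + j ≤ finrank K V) :
    B.card ≤ (Finset.univ.filter fun A : Submodule K V => finrank K A = e ∧ 
      ∃ P ∈ B, Disjoint P A).card := by
  set N := Finset.univ.filter fun A : Submodule K V => finrank K A = e ∧ 
      ∃ P ∈ B, Disjoint P A with hN
  let f : B → (N → ℚ) := fun P A => if Disjoint P.1 A.1 then 1 else 0
  have hf : LinearIndependent ℚ f := by
    rw [Fintype.linearIndependent_iff]
    intro c hc
    refine core (fun P : B => P.1) Subtype.val_injective j t e (fun P => hj _ P.2) 
      (fun P Q => hint _ P.2 _ Q.2) hte hen c ?_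
    intro v
    by_cases hv : goodT (⊥ : Submodule K V) v ∧ ∃ P ∈ B, Disjoint P (Submodule.span K (Set.range v))
    · have := congrFun hc ⟨Submodule.span K (Set.range v), Finset.mem_filter.2 
        ⟨Finset.mem_univ _, (good_bot v).1 hv.1, hv.2⟩⟩
      simp only [f, Finset.sum_apply, Pi.smul_apply, smul_eq_mul, Pi.zero_apply] at this
      refine Eq.trans ?_ this
      refine Finset.sum_congr rfl fun P _ => ?_
      congr 1
      refine if_congr ?_ rfl rfl
      rw [good_iff P.1 v]
      simp only [hv.1, true_and]
    · refine Finset.sum_eq_zero fun P _ => ?_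
      rw [if_neg, mul_zero]
      rw [good_iff]
      exact fun h => hv ⟨h.1, P.1, P.2, h.2⟩
  have := hf.fintype_card_le_finrank
  simpa using this

end aux2

lemma weier (q : ℤ) (hq : 2 ≤ q) (n s : ℕ) : ∀ m, s + m ≤ n →
    (q ^ n) ^ m * (q ^ n - q ^ (s + m)) ≤ (∏ i ∈ Finset.range m, (q ^ n - q ^ (s + i))) * q ^ n := by
  intro m
  induction m with
  | zero =>
    intro _
    have : 0 < q ^ s := pow_pos (by linarith) _
    simp; linarith
  | succ m ih =>
    intro h
    have h1 := ih (by omega)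
    rw [Finset.prod_range_succ]
    have hx : 0 < q ^ n := pow_pos (by linarith) _
    have hy : 0 < q ^ (s+m) := pow_pos (by linarith) _
    have hxy : q ^ (s + m) ≤ q ^ n := pow_le_pow_right₀ (by linarith) (by omega)
    have h2 := mul_le_mul_of_nonneg_right h1 (sub_nonneg.2 hxy)
    have h3 : q ^ (s + (m+1)) = q * q ^ (s+m) := by ring
    rw [h3]
    have h4 : 0 < (q ^ n) ^ m := pow_pos hx _
    have h5 : q ^ n * (q ^ n - q * q ^ (s+m)) ≤ (q ^ n - q ^ (s+m)) * (q ^ n - q ^ (s+m)) := by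
      nlinarith [mul_pos hx hy, mul_pos hy hy]
    have h6 := mul_le_mul_of_nonneg_left h5 h4.le
    calc _ = (q ^ n) ^ m * (q ^ n * (q ^ n - q * q ^ (s+m))) := by ring
      _ ≤ _ := h6
      _ = _ := by ring
      _ ≤ _ := h2
      _ = _ := by ring

lemma M_le (q : ℤ) (hq : 2 ≤ q) (n a : ℕ) (h : a ≤ n) :
    ∏ i ∈ Finset.range a, (q ^ n - q ^ i) ≤ (q ^ n) ^ a := by
  have : (q ^ n) ^ a = ∏ i ∈ Finset.range a, q ^ n := by simp
  rw [this]
  refine Finset.prod_le_prod (fun i hi => ?_) (fun i _ => ?_)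
  · have : q ^ i ≤ q ^ n := pow_le_pow_right₀ (by linarith) (by have := Finset.mem_range.1 hi; omega)
    linarith
  · have : 0 < q ^ i := pow_pos (by linarith) _
    linarith

lemma M_lt (q : ℤ) (hq : 2 ≤ q) (n a : ℕ) (h : a + 1 ≤ n) :
    ∏ i ∈ Finset.range (a+1), (q ^ n - q ^ i) < (q ^ n) ^ (a+1) := by
  have h1 := M_le q hq n a (by omega)
  rw [Finset.prod_range_succ, pow_succ]
  have hx : 0 < q ^ n := pow_pos (by linarith) _
  have hy : 0 < q ^ a := pow_pos (by linarith) _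
  have hxy : q ^ a ≤ q ^ n := pow_le_pow_right₀ (by linarith) (by omega)
  have h2 := mul_le_mul_of_nonneg_right h1 (sub_nonneg.2 hxy)
  have h4 : 0 < (q ^ n) ^ a := pow_pos hx _
  nlinarith [mul_pos h4 hy]

lemma ineq1 (q : ℤ) (hq : 2 ≤ q) (n a : ℕ) (h : 2 * a + 4 ≤ n) :
    ∏ i ∈ Finset.range a, (q ^ n - q ^ i) ≤ q * ∏ i ∈ Finset.range a, (q ^ n - q ^ (a + 3 + i)) := by
  refine (M_le q hq n a (by omega)).trans ?_
  have h1 := weier q hq n (a+3) a (by omega)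
  have hx : 0 < q ^ n := pow_pos (by linarith) _
  have h4 : 0 < (q ^ n) ^ a := pow_pos hx _
  have h5 : q * q ^ (a+3+a) ≤ q ^ n := by
    rw [mul_comm, ← pow_succ]
    exact pow_le_pow_right₀ (by linarith) (by omega)
  refine le_of_mul_le_mul_right ?_ hx
  have h6 := mul_le_mul_of_nonneg_left h1 (show 0 ≤ q by linarith)
  have h7 : (q ^ n) ^ a * q ^ n ≤ (q ^ n) ^ a * (q * (q ^ n - q ^ (a+3+a))) :=
    mul_le_mul_of_nonneg_left (by nlinarith) h4.le
  calc _ ≤ _ := h7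
    _ = _ := by ring
    _ ≤ _ := h6
    _ = _ := by ring

lemma ineq2 (q : ℤ) (hq : 2 ≤ q) (m : ℕ) :
    (q - 1) * ∏ i ∈ Finset.range (m+1), (q ^ (2*m+5) - q ^ i) <
      q * (q * ∏ i ∈ Finset.range (m+1), (q ^ (2*m+5) - q ^ (m + 1 + 3 + i))) := by
  have h0 := M_lt q hq (2*m+5) m (by omega)
  have h1 := weier q hq (2*m+5) (m+4) m (by omega)
  have hx : 0 < q ^ (2*m+5) := pow_pos (by linarith) _
  rw [Finset.prod_range_succ (fun i => q ^ (2*m+5) - q ^ (m + 1 + 3 + i))]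
  have e : ∏ i ∈ Finset.range m, (q ^ (2*m+5) - q ^ (m + 1 + 3 + i))
    = ∏ i ∈ Finset.range m, (q ^ (2*m+5) - q ^ (m + 4 + i)) := rfl
  rw [e]
  set R0 := ∏ i ∈ Finset.range m, (q ^ (2*m+5) - q ^ (m + 4 + i))
  have e2 : q ^ (m+4+m) = q ^ (2*m+4) := by congr 1; omega
  have e3 : q ^ (m+1+3+m) = q ^ (2*m+4) := by rw [show m+1+3+m = 2*m+4 by omega]
  rw [e2] at h1
  rw [e3]
  have e4 : q ^ (2*m+5) = q * q ^ (2*m+4) := by ring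
  set y := q ^ (2*m+4) with hy
  have hy0 : 0 < y := pow_pos (by linarith) _
  rw [e4] at h0 h1 ⊢
  have hxm : 0 < (q * y) ^ m := pow_pos (mul_pos (by linarith) hy0) _
  have h2 : (q * y) ^ m * (q - 1) ≤ R0 * q := by
    refine le_of_mul_le_mul_right ?_ hy0
    calc _ = _ := by ring
      _ ≤ _ := h1
      _ = _ := by ring
  have h3 : (q-1) * (q-1) * (q * y) ^ (m+1) ≤ q * (q * (R0 * (q * y - y))) := by
    have := mul_le_mul_of_nonneg_right h2 (show 0 ≤ q * (q-1) * y by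
      refine mul_nonneg (mul_nonneg ?_ ?_) hy0.le <;> linarith)
    calc _ = _ := by ring
      _ ≤ _ := this
      _ = _ := by ring
  refine lt_of_lt_of_le ?_ h3
  rw [mul_assoc]
  refine mul_lt_mul_of_pos_left ?_ (by linarith)
  refine h0.trans_le ?_
  have : 0 < (q * y) ^ (m+1) := pow_pos (mul_pos (by linarith) hy0) _
  nlinarith

section aux3
open Classical
variable {K V : Type*} [Field K] [AddCommGroup V] [Module K V] [FiniteDimensional K V]
variable [Fintype K] [Fintype V] [Fintype (Submodule K V)]

lemma codeg2 (a : ℕ) (P Q : Submodule K V) (h : P ≠ Q) (hP : finrank K P = a + 2)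
    (hQ : finrank K Q = a + 2) (hn : 2 * a + 3 ≤ finrank K V) (k c : ℤ)
    (hk : k = ((Finset.univ.filter fun A : Submodule K V => finrank K A = a + 1 ∧ Disjoint P A).card : ℤ))
    (hc : c = ((Finset.univ.filter fun A : Submodule K V => finrank K A = a + 1 ∧ 
      (Disjoint P A ∧ Disjoint Q A)).card : ℤ)) :
    (Fintype.card K : ℤ) * ∏ i ∈ Finset.range a, ((Fintype.card K : ℤ) ^ finrank K V
          - (Fintype.card K : ℤ) ^ (a + 3 + i)) 
      ≤ (k - c) * ∏ i ∈ Finset.range a, ((Fintype.card K : ℤ) ^ a - (Fintype.card K : ℤ) ^ i) ∧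
    (finrank K V = 2 * a + 3 → 
      k * ∏ i ∈ Finset.range a, ((Fintype.card K : ℤ) ^ a - (Fintype.card K : ℤ) ^ i) =
      (Fintype.card K : ℤ) * ((Fintype.card K : ℤ) * ∏ i ∈ Finset.range a, ((Fintype.card K : ℤ) ^ finrank K V
          - (Fintype.card K : ℤ) ^ (a + 3 + i)))) := by
  have h1 := card_disj' (a+1) P
  have h2 := codeg_bound a (a+1) P Q h hP hQ (by omega)
  have hq := q_ge K
  rw [← hk, hP, Finset.prod_range_succ' (fun i => (Fintype.card K:ℤ)^finrank K V - (Fintype.card K:ℤ)^(a+2+i))] at h1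
  rw [← hc] at h2
  set q : ℤ := (Fintype.card K : ℤ) with hqdef
  set n := finrank K V with hndef
  have e : ∏ i ∈ Finset.range a, (q ^ n - q ^ (a + 2 + (i+1))) 
    = ∏ i ∈ Finset.range a, (q ^ n - q ^ (a + 3 + i)) := 
    Finset.prod_congr rfl fun i _ => by congr 2; omega
  have e' : ∏ i ∈ Finset.range a, (q ^ n - q ^ (a + 1 + 2 + i)) 
    = ∏ i ∈ Finset.range a, (q ^ n - q ^ (a + 3 + i)) := 
    Finset.prod_congr rfl fun i _ => by congr 2
  rw [e] at h1
  rw [e'] at h2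
  rw [prod_succ_shift] at h1 h2
  set P' := ∏ i ∈ Finset.range a, (q ^ n - q ^ (a + 3 + i))
  set γ := ∏ i ∈ Finset.range a, (q ^ a - q ^ i)
  have hy : 0 < q ^ a := pow_pos (by linarith) _
  have hy1 : 1 < q ^ (a+1) := one_lt_pow₀ (by linarith) (by omega)
  have hpos : 0 < (q ^ (a+1) - 1) * q ^ a := mul_pos (by linarith) hy
  have e3 : q ^ (a + 1 + 1) = q * q * q ^ a := by ring
  have e4 : q ^ (a + 1) = q * q ^ a := by ring
  have e5 : q ^ (a + 2) = q * q * q ^ a := by ring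
  have e6 : q ^ (a + 1 + 1 + a) = q * q * q ^ a * q ^ a := by ring
  constructor
  · refine le_of_mul_le_mul_left ?_ hpos
    simp only [add_zero] at h1
    rw [e3, e6, e4] at h2
    rw [e4, e5] at h1
    rw [e4]
    nlinarith [h1, h2]
  · intro hn'
    have e7 : q ^ n = q * q * q * q ^ a * q ^ a := by rw [hn']; ring
    refine mul_left_cancel₀ hpos.ne' ?_
    simp only [add_zero] at h1
    rw [e4, e5] at h1
    rw [e4]
    have e8 : q ^ n - q * q * q ^ a = (q * q ^ a - 1) * q ^ a * (q * q) := by rw [e7]; ring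
    rw [e8] at h1
    linear_combination h1

lemma hilton (d : ℕ) (hd : 1 ≤ d) (hn : 2 * d + 1 ≤ finrank K V) (B : Finset (Submodule K V))
    (hne : B.Nonempty) (hB : ∀ P ∈ B, finrank K P = d + 1) 
    (hint : ∀ P ∈ B, ∀ Q ∈ B, d + 1 ≤ finrank K ↥(P ⊓ Q) + (d - 1)) (k N : ℤ) 
    (hk : k = (Fintype.card K : ℤ) ^ (d * (d + 1)) * gbinom (Fintype.card K) (finrank K V - (d + 1)) d)
    (hN : N = (Finset.univ.filter fun A : Submodule K V => finrank K A = d ∧ 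
      ∃ P ∈ B, Disjoint P A).card) :
    k + B.card - 1 ≤ N ∧ (2 * d + 2 ≤ finrank K V → 2 ≤ B.card → k + B.card ≤ N) := by
  have hq := q_ge K
  obtain ⟨a, rfl⟩ : ∃ a, d = a + 1 := ⟨d - 1, by omega⟩
  have hD : ∀ P ∈ B, k = ((Finset.univ.filter fun A : Submodule K V => 
      finrank K A = a + 1 ∧ Disjoint P A).card : ℤ) := by
    intro P hP
    rw [card_disj, hB P hP, hk]
  by_cases h1 : B.card ≤ 1
  · obtain ⟨P, hP⟩ := hne
    refine ⟨?_, fun _ h => by omega⟩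
    have : k ≤ N := by
      rw [hD P hP, hN]
      norm_cast
      refine Finset.card_le_card fun A hA => ?_
      simp only [Finset.mem_filter, Finset.mem_univ, true_and] at hA ⊢
      exact ⟨hA.1, P, hP, hA.2⟩
    have : (B.card : ℤ) ≤ 1 := by exact_mod_cast h1
    linarith
  have hb2 : 2 ≤ B.card := by omega
  have hb2' : (2:ℤ) ≤ B.card := by exact_mod_cast hb2
  have hγ := gamma_pos (Fintype.card K : ℤ) hq a
  -- rank bound
  have hbM : (B.card : ℤ) * ∏ i ∈ Finset.range a, ((Fintype.card K : ℤ) ^ a - (Fintype.card K : ℤ) ^ i) 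
      ≤ ∏ i ∈ Finset.range a, ((Fintype.card K : ℤ) ^ finrank K V - (Fintype.card K : ℤ) ^ i) := by
    rw [← gbinom_eq (Fintype.card K) (finrank K V) a]
    refine mul_le_mul_of_nonneg_right ?_ hγ.le
    rw [← card_dim (K := K) (V := V)]
    have := rank_bound B (a+2) a a hB (fun P hP Q hQ => hint P hP Q hQ) le_rfl (by omega)
    norm_cast
    refine le_trans this (Finset.card_le_card fun A hA => ?_)
    simp only [Finset.mem_filter, Finset.mem_univ, true_and] at hA ⊢
    exact hA.1
  by_cases hn2 : 2 * a + 4 ≤ finrank K V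
  · suffices k + B.card ≤ N from ⟨by linarith, fun _ _ => this⟩
    obtain ⟨P, hP, Q, hQ, hPQ⟩ := Finset.one_lt_card.1 (show 1 < B.card by omega)
    have h2 := (codeg2 a P Q hPQ (hB P hP) (hB Q hQ) (by omega) k _ (hD P hP) rfl).1
    have h3 := ineq1 _ hq _ a hn2
    have h4 := le_of_mul_le_mul_right ((hbM.trans h3).trans h2) hγ
    have h5 := Finset.card_union_add_card_inter 
      (Finset.univ.filter fun A : Submodule K V => finrank K A = a + 1 ∧ Disjoint P A)
      (Finset.univ.filter fun A : Submodule K V => finrank K A = a + 1 ∧ Disjoint Q A)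
    have h6 : (Finset.univ.filter fun A : Submodule K V => finrank K A = a + 1 ∧ Disjoint P A) ∩
      (Finset.univ.filter fun A : Submodule K V => finrank K A = a + 1 ∧ Disjoint Q A) =
      (Finset.univ.filter fun A : Submodule K V => finrank K A = a + 1 ∧ 
      (Disjoint P A ∧ Disjoint Q A)) := by
      ext A
      simp only [Finset.mem_inter, Finset.mem_filter, Finset.mem_univ, true_and]
      tauto
    have h7 : (((Finset.univ.filter fun A : Submodule K V => finrank K A = a + 1 ∧ Disjoint P A) ∪
      (Finset.univ.filter fun A : Submodule K V => finrank K A = a + 1 ∧ Disjoint Q A)).card : ℤ) ≤ N := by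
      rw [hN]
      norm_cast
      refine Finset.card_le_card ?_
      intro A
      simp only [Finset.mem_union, Finset.mem_filter, Finset.mem_univ, true_and]
      rintro (h | h)
      · exact ⟨h.1, P, hP, h.2⟩
      · exact ⟨h.1, Q, hQ, h.2⟩
    rw [h6] at h5
    have h8 := congrArg (Nat.cast : ℕ → ℤ) h5
    push_cast at h8
    rw [← hD P hP, ← hD Q hQ] at h8
    linarith
  have hn3 : finrank K V = 2 * a + 3 := by omega
  refine ⟨?_, fun h => by omega⟩
  set q : ℤ := (Fintype.card K : ℤ) with hqdef
  set b : ℤ := (B.card : ℤ) with hb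
  set NN := Finset.univ.filter fun A : Submodule K V => finrank K A = a + 1 ∧ 
      ∃ P ∈ B, Disjoint P A with hNN
  have hcod : ∀ P ∈ B, ∀ Q ∈ B, P ≠ Q → q * ((Finset.univ.filter fun A : Submodule K V => finrank K A = a + 1 ∧ 
      (Disjoint P A ∧ Disjoint Q A)).card : ℤ) ≤ (q - 1) * k := by
    intro P hP Q hQ hPQ
    obtain ⟨h2, h3⟩ := codeg2 a P Q hPQ (hB P hP) (hB Q hQ) (by omega) k _ (hD P hP) rfl
    have h3 := h3 hn3
    have h4 := mul_le_mul_of_nonneg_left h2 (show 0 ≤ q by linarith)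
    rw [← h3, ← mul_assoc] at h4
    have := le_of_mul_le_mul_right h4 hγ
    linarith
  -- a ≥ 1
  have hkb : (q - 1) * b + 1 ≤ k := by
    obtain ⟨P, hP, Q, hQ, hPQ⟩ := Finset.one_lt_card.1 (show 1 < B.card by omega)
    have h3 := (codeg2 a P Q hPQ (hB P hP) (hB Q hQ) (by omega) k _ (hD P hP) rfl).2 hn3
    rcases Nat.eq_zero_or_pos a with rfl | ha
    · simp at hbM; linarith
    · obtain ⟨m, rfl⟩ : ∃ m, a = m + 1 := ⟨a - 1, by omega⟩
      have h4 := ineq2 q hq m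
      have hn4 : finrank K V = 2 * m + 5 := by omega
      rw [hn4] at h3 hbM
      rw [← h3] at h4
      have h5 := mul_le_mul_of_nonneg_left hbM (show 0 ≤ q - 1 by linarith)
      have h6 := h5.trans_lt h4
      rw [← mul_assoc] at h6
      have := lt_of_mul_lt_mul_right h6 hγ.le
      linarith
  have hk0 : 0 < k := by nlinarith
  let m : Submodule K V → ℤ := fun A => ∑ P ∈ B, if Disjoint P A then 1 else 0
  have s1 : ∑ A ∈ NN, m A = b * k := by
    rw [Finset.sum_comm, Finset.sum_congr rfl (g := fun _ => k)]
    · simp [hb]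
    · intro P hP
      rw [hD P hP, Finset.sum_boole, hNN, Finset.filter_filter]
      congr 2
      ext A
      simp only [Finset.mem_filter, Finset.mem_univ, true_and]
      exact ⟨fun h => ⟨h.1.1, h.2⟩, fun h => ⟨⟨h.1, P, hP, h.2⟩, h.2⟩⟩
  have s2 : q * ∑ A ∈ NN, m A ^ 2 ≤ b * k * (1 + b * (q - 1)) := by
    have e1 : ∑ A ∈ NN, m A ^ 2 = ∑ P ∈ B, ∑ Q ∈ B, ∑ A ∈ NN, 
        if (Disjoint P A ∧ Disjoint Q A) then (1:ℤ) else 0 := by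
      have : ∀ A ∈ NN, m A ^ 2 = ∑ P ∈ B, ∑ Q ∈ B, if (Disjoint P A ∧ Disjoint Q A) then (1:ℤ) else 0 := by
        intro A _
        simp only [m]
        rw [sq, Finset.sum_mul_sum]
        refine Finset.sum_congr rfl fun P _ => Finset.sum_congr rfl fun Q _ => ?_
        by_cases h1 : Disjoint P A <;> by_cases h2 : Disjoint Q A <;> simp [h1, h2]
      rw [Finset.sum_congr rfl this, Finset.sum_comm]
      refine Finset.sum_congr rfl fun P _ => Finset.sum_comm
    have e2 : ∀ P ∈ B, ∀ Q ∈ B, q * ∑ A ∈ NN, (if (Disjoint P A ∧ Disjoint Q A) then (1:ℤ) else 0) ≤ 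
        (q - 1) * k + if P = Q then k else 0 := by
      intro P hP Q hQ
      have e3 : ∑ A ∈ NN, (if (Disjoint P A ∧ Disjoint Q A) then (1:ℤ) else 0) = 
        ((Finset.univ.filter fun A : Submodule K V => finrank K A = a + 1 ∧ 
      (Disjoint P A ∧ Disjoint Q A)).card : ℤ) := by
        rw [Finset.sum_boole, hNN, Finset.filter_filter]
        congr 2
        ext A
        simp only [Finset.mem_filter, Finset.mem_univ, true_and]
        exact ⟨fun h => ⟨h.1.1, h.2⟩, fun h => ⟨⟨h.1, P, hP, h.2.1⟩, h.2⟩⟩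
      rw [e3]
      by_cases hPQ : P = Q
      · subst hPQ
        simp only [and_self, if_true]
        rw [hD P hP]
        apply le_of_eq; ring
      · rw [if_neg hPQ, add_zero]
        exact hcod P hP Q hQ hPQ
    rw [e1]
    simp only [Finset.mul_sum] at e2 ⊢
    calc _ ≤ ∑ P ∈ B, ∑ Q ∈ B, ((q - 1) * k + if P = Q then k else 0) :=
          Finset.sum_le_sum fun P hP => Finset.sum_le_sum fun Q hQ => e2 P hP Q hQ
      _ = ∑ P ∈ B, (b * ((q - 1) * k) + k) := by
          refine Finset.sum_congr rfl fun P hP => ?_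
          rw [Finset.sum_add_distrib, Finset.sum_ite_eq, if_pos hP]
          simp [hb]
      _ = _ := by
          rw [Finset.sum_const, nsmul_eq_mul, ← hb]; ring
  have s3 := sq_sum_le_card_mul_sum_sq (s := NN) (f := m)
  rw [s1, ← hN] at s3
  have hN0 : 0 ≤ N := by rw [hN]; positivity
  have s4 := mul_le_mul_of_nonneg_left s2 hN0
  have s5 := mul_le_mul_of_nonneg_left s3 (show 0 ≤ q by linarith)
  have hbk : 0 < b * k := mul_pos (by linarith) hk0
  have s6 : b * k * q ≤ N * (1 + b * (q-1)) := by
    refine le_of_mul_le_mul_left ?_ hbk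
    nlinarith
  by_contra hlt
  have hlt : N ≤ k + b - 2 := by
    rw [not_le] at hlt
    linarith [Int.add_one_le_iff.2 hlt]
  have s7 : N * (1 + b * (q-1)) ≤ (k + b - 2) * (1 + b * (q-1)) := 
    mul_le_mul_of_nonneg_right hlt (by nlinarith)
  have s8 : (b - 2) * (1 + b * (q-1)) ≤ (b-2) * k := mul_le_mul_of_nonneg_left (by linarith) (by linarith)
  nlinarith

end aux3

section aux4
open Classical
variable {K V : Type*} [Field K] [AddCommGroup V] [Module K V] [FiniteDimensional K V]
variable [Fintype K] [Fintype V] [Fintype (Submodule K V)]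

/-- layer of a family. -/
noncomputable def lay (F : Finset (Submodule K V)) (i : ℕ) : Finset (Submodule K V) :=
  F.filter fun A => finrank K A = i

lemma mem_lay (F : Finset (Submodule K V)) (i : ℕ) (A : Submodule K V) :
    A ∈ lay F i ↔ A ∈ F ∧ finrank K A = i := by simp [lay]

/-- members of dimension `e` disjoint from some member of `B`. -/
noncomputable def nbr (B : Finset (Submodule K V)) (e : ℕ) : Finset (Submodule K V) :=
  Finset.univ.filter fun A : Submodule K V => finrank K A = e ∧ ∃ P ∈ B, Disjoint P A

lemma mem_nbr (B : Finset (Submodule K V)) (e : ℕ) (A : Submodule K V) :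
    A ∈ nbr B e ↔ finrank K A = e ∧ ∃ P ∈ B, Disjoint P A := by simp [nbr]

lemma dim_le (F : Finset (Submodule K V)) (d : ℕ)
    (hF : ∀ A ∈ F, ∀ B ∈ F, finrank K ↥(A ⊔ B) ≤ 2 * d) (A) (hA : A ∈ F) : finrank K A ≤ 2 * d := by
  have := hF A hA A hA
  rwa [sup_idem] at this

lemma fr_disj {P A : Submodule K V} (h : Disjoint P A) :
    finrank K ↥(A ⊔ P) = finrank K A + finrank K P := by
  have h1 := Submodule.finrank_sup_add_finrank_inf_eq A P
  rw [inf_comm, h.eq_bot, finrank_bot] at h1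
  omega

lemma lay_add_le (F : Finset (Submodule K V)) (i : ℕ) (S : Finset (Submodule K V))
    (hS : ∀ A ∈ S, finrank K A = i) (h : ∀ A ∈ F, finrank K A = i → A ∉ S) :
    ((lay F i).card : ℤ) + (S.card : ℤ) ≤ gbinom (Fintype.card K) (finrank K V) i := by
  rw [← card_dim]
  norm_cast
  rw [← Finset.card_union_of_disjoint]
  · refine Finset.card_le_card fun A hA => ?_
    simp only [Finset.mem_union, mem_lay, Finset.mem_filter, Finset.mem_univ, true_and] at hA ⊢
    rcases hA with hA | hA
    · exact hA.2
    · exact hS A hA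
  · rw [Finset.disjoint_left]
    intro A hA hA2
    rw [mem_lay] at hA
    exact h A hA.1 hA.2 hA2

lemma lay_int (F : Finset (Submodule K V)) (d : ℕ)
    (hF : ∀ A ∈ F, ∀ B ∈ F, finrank K ↥(A ⊔ B) ≤ 2 * d) (j : ℕ) :
    ∀ P ∈ lay F j, ∀ Q ∈ lay F j, 2 * j ≤ finrank K ↥(P ⊓ Q) + 2 * d := by
  intro P hP Q hQ
  rw [mem_lay] at hP hQ
  have h1 := Submodule.finrank_sup_add_finrank_inf_eq P Q
  have h2 := hF P hP.1 Q hQ.1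
  omega

lemma pair_le (F : Finset (Submodule K V)) (d : ℕ) (hn : 2 * d < finrank K V)
    (hF : ∀ A ∈ F, ∀ B ∈ F, finrank K ↥(A ⊔ B) ≤ 2 * d) (i : ℕ) (hi : i ≤ d) :
    ((lay F i).card : ℤ) + ((lay F (2 * d + 1 - i)).card : ℤ)
      ≤ gbinom (Fintype.card K) (finrank K V) i := by
  rcases Nat.eq_zero_or_pos i with rfl | hi0
  · have : lay F (2 * d + 1 - 0) = ∅ := by
      rw [Finset.eq_empty_iff_forall_notMem]
      intro A hA
      rw [mem_lay] at hA
      have := dim_le F d hF A hA.1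
      omega
    have h0 := lay_add_le F 0 ∅ (by simp) (by simp)
    rw [this]
    exact h0
  · have h1 : (lay F (2 * d + 1 - i)).card ≤ (nbr (lay F (2 * d + 1 - i)) i).card := rank_bound (lay F (2 * d + 1 - i)) (2 * d + 1 - i) (i - 1) i 
      (fun P hP => ((mem_lay _ _ _).1 hP).2) (fun P hP Q hQ => by
        have := lay_int F d hF _ P hP Q hQ
        omega) (by omega) (by omega)
    have h0 := lay_add_le F i (nbr (lay F (2 * d + 1 - i)) i) (fun A hA => ((mem_nbr _ _ _).1 hA).1) (by
      intro A hA hAi hm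
      obtain ⟨P, hP, hd⟩ := ((mem_nbr _ _ _).1 hm).2
      rw [mem_lay] at hP
      have := hF A hA P hP.1
      rw [fr_disj hd] at this
      omega)
    have h2 := Int.ofNat_le.2 h1
    linarith

lemma sum_lay (F : Finset (Submodule K V)) (d : ℕ) 
    (hF : ∀ A ∈ F, ∀ B ∈ F, finrank K ↥(A ⊔ B) ≤ 2 * d) :
    (F.card : ℤ) = ∑ i ∈ Finset.range (d + 1), 
      (((lay F i).card : ℤ) + ((lay F (2 * d + 1 - i)).card : ℤ)) := by
  have h1 : F.card = ∑ i ∈ Finset.range ((d+1) + (d+1)), (lay F i).card := by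
    refine Finset.card_eq_sum_card_fiberwise (f := fun A : Submodule K V => finrank K A) ?_
    intro A hA
    have := dim_le F d hF A hA
    simp only [Finset.coe_range, Set.mem_Iio]
    omega
  rw [h1, Finset.sum_range_add, ← Finset.sum_range_reflect (fun x => (lay F (d + 1 + x)).card)]
  push_cast
  rw [Finset.sum_add_distrib]
  congr 1
  refine Finset.sum_congr rfl fun i hi => ?_
  have := Finset.mem_range.1 hi
  rw [show d + 1 + (d - i) = 2 * d + 1 - i by omega]

lemma mid_le (F : Finset (Submodule K V)) (d : ℕ) (hd : 1 ≤ d) (hn : 2 * d < finrank K V)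
    (hF : ∀ A ∈ F, ∀ B ∈ F, finrank K ↥(A ⊔ B) ≤ 2 * d) (k : ℤ)
    (hk : k = (Fintype.card K : ℤ) ^ (d * (d + 1)) * gbinom (Fintype.card K) (finrank K V - (d + 1)) d)
    (hne : (lay F (d+1)).Nonempty) :
    ((lay F d).card : ℤ) + ((lay F (d + 1)).card : ℤ)
      ≤ gbinom (Fintype.card K) (finrank K V) d - k + 1 ∧
    (2 * d + 2 ≤ finrank K V → 2 ≤ (lay F (d+1)).card → 
      ((lay F d).card : ℤ) + ((lay F (d + 1)).card : ℤ)
      ≤ gbinom (Fintype.card K) (finrank K V) d - k) := by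
  obtain ⟨h1, h2⟩ := hilton d hd (by omega) (lay F (d+1)) hne (fun P hP => ((mem_lay _ _ _).1 hP).2) 
    (fun P hP Q hQ => by
        have := lay_int F d hF _ P hP Q hQ
        omega) k ((nbr (lay F (d + 1)) d).card : ℤ) hk rfl
  have h0 := lay_add_le F d (nbr (lay F (d + 1)) d) (fun A hA => ((mem_nbr _ _ _).1 hA).1) (by
    intro A hA hAi hm
    obtain ⟨P, hP, hd⟩ := ((mem_nbr _ _ _).1 hm).2
    rw [mem_lay] at hP
    have := hF A hA P hP.1
    rw [fr_disj hd] at this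
    omega)
  exact ⟨by linarith, 
    fun a b => by linarith [h2 a b]⟩

lemma not_disj (F : Finset (Submodule K V)) (d : ℕ) 
    (hF : ∀ A ∈ F, ∀ B ∈ F, finrank K ↥(A ⊔ B) ≤ 2 * d) (B : Submodule K V) (hB : B ∈ F)
    (U : Submodule K V) (hU : U ≤ B) (hUd : finrank K U = d + 1) : 
    ∀ A ∈ F, finrank K A = d → ¬ Disjoint U A := by
  intro A hA hAd h
  have h1 := fr_disj h
  have h2 := Submodule.finrank_mono (sup_le_sup_left hU A)
  have h3 := hF A hA B hB
  omega

lemma low_le (F : Finset (Submodule K V)) (d : ℕ) 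
    (hF : ∀ A ∈ F, ∀ B ∈ F, finrank K ↥(A ⊔ B) ≤ 2 * d) (k : ℤ)
    (hk : k = (Fintype.card K : ℤ) ^ (d * (d + 1)) * gbinom (Fintype.card K) (finrank K V - (d + 1)) d)
    (B : Submodule K V) (hB : B ∈ F) (U : Submodule K V) (hU : U ≤ B) (hUd : finrank K U = d + 1) : 
    ((lay F d).card : ℤ) + k ≤ gbinom (Fintype.card K) (finrank K V) d := by
  have h := lay_add_le F d (Finset.univ.filter fun A : Submodule K V => finrank K A = d ∧ Disjoint U A)
    (fun A hA => (Finset.mem_filter.1 hA).2.1) (fun A hA hAd hm => 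
      not_disj F d hF B hB U hU hUd A hA hAd (Finset.mem_filter.1 hm).2.2)
  rw [card_disj, hUd] at h
  rw [hk]
  exact h

lemma exists_sub (B : Submodule K V) (e : ℕ) (h : e ≤ finrank K B) : 
    ∃ U ≤ B, finrank K U = e := by
  induction e with
  | zero => exact ⟨⊥, bot_le, finrank_bot K V⟩
  | succ e ih =>
    obtain ⟨U, hU, hUe⟩ := ih (by omega)
    obtain ⟨x, hx, hxW⟩ : ∃ x ∈ B, x ∉ U := by
      by_contra! hc2
      have := Submodule.finrank_mono (show B ≤ U from hc2)
      omega
    exact ⟨U ⊔ Submodule.span K {x}, sup_le hU (by simpa using hx), by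
      rw [fr_sup_single _ hxW]; omega⟩

lemma exists_sub_ne (B U : Submodule K V) (e : ℕ) (he : 1 ≤ e) (h : e + 1 ≤ finrank K B) : 
    ∃ U' ≤ B, finrank K U' = e ∧ U' ≠ U := by
  by_contra! hc
  obtain ⟨W, hW, hWe⟩ := exists_sub B e (by omega)
  have hWU := hc W hW hWe
  obtain ⟨x, hx, hxW⟩ : ∃ x ∈ B, x ∉ W := by
    by_contra! hc2
    have := Submodule.finrank_mono (show B ≤ W from hc2)
    omega
  obtain ⟨W2, hW2, hW2e⟩ := exists_sub W (e - 1) (by omega)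
  have hxW2 : x ∉ W2 := fun h => hxW (hW2 h)
  have h3 := hc (W2 ⊔ Submodule.span K {x}) (sup_le (hW2.trans hW) (by simpa using hx)) (by
    rw [fr_sup_single _ hxW2]; omega)
  exact hxW (by
    rw [hWU, ← h3]
    exact Submodule.mem_sup_right (Submodule.mem_span_singleton_self x))

lemma bound (F : Finset (Submodule K V)) (d : ℕ) (hd : 1 ≤ d) (hn : 2 * d < finrank K V)
    (hF : ∀ A ∈ F, ∀ B ∈ F, finrank K ↥(A ⊔ B) ≤ 2 * d) (k : ℤ)
    (hk : k = (Fintype.card K : ℤ) ^ (d * (d + 1)) * gbinom (Fintype.card K) (finrank K V - (d + 1)) d)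
    (hnK : ∃ B ∈ F, d < finrank K B) :
    (F.card : ℤ) ≤ (∑ i ∈ Finset.range (d + 1), (gbinom (Fintype.card K) (finrank K V) i : ℤ)) - k + 1 ∧
    (2 * d + 2 ≤ finrank K V → (F.card : ℤ) = 
      (∑ i ∈ Finset.range (d + 1), (gbinom (Fintype.card K) (finrank K V) i : ℤ)) - k + 1 →
      ∃ U : Submodule K V, finrank K U = d + 1 ∧ ∀ A, A ∈ F ↔ 
        (finrank K A ≤ d ∧ ¬ (finrank K A = d ∧ Disjoint U A)) ∨ A = U) := by
  rw [sum_lay F d hF, Finset.sum_range_succ, Finset.sum_range_succ]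
  rw [show 2 * d + 1 - d = d + 1 by omega]
  have hp : ∀ i ∈ Finset.range d, ((lay F i).card : ℤ) + ((lay F (2 * d + 1 - i)).card : ℤ)
      ≤ gbinom (Fintype.card K) (finrank K V) i := fun i hi => 
    pair_le F d hn hF i (Finset.mem_range.1 hi).le
  have hps := Finset.sum_le_sum hp
  by_cases hne : (lay F (d+1)).Nonempty
  · obtain ⟨h1, h2⟩ := mid_le F d hd hn hF k hk hne
    refine ⟨by linarith, fun hn2 heq => ?_⟩
    have hc1 : (lay F (d+1)).card = 1 := by
      by_contra hc
      have := hne.card_pos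
      have := h2 hn2 (by omega)
      linarith
    obtain ⟨U, hU⟩ := Finset.card_eq_one.1 hc1
    have hUm : U ∈ lay F (d+1) := by rw [hU]; simp
    have hUF := (mem_lay _ _ _).1 hUm
    rw [hc1] at h1 heq
    push_cast at h1 heq
    have hbd : ((lay F d).card : ℤ) + k = gbinom (Fintype.card K) (finrank K V) d := by linarith
    have hlow : lay F d = Finset.univ.filter fun A : Submodule K V => finrank K A = d ∧ ¬ Disjoint U A := by
      refine Finset.eq_of_subset_of_card_le ?_ ?_
      · intro A hA
        rw [mem_lay] at hA
        simp only [Finset.mem_filter, Finset.mem_univ, true_and]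
        exact ⟨hA.2, not_disj F d hF U hUF.1 U le_rfl hUF.2 A hA.1 hA.2⟩
      · have e1 := Finset.card_filter_add_card_filter_not (s := Finset.univ.filter fun A : Submodule K V => finrank K A = d)
          (fun A => Disjoint U A)
        rw [Finset.filter_filter, Finset.filter_filter] at e1
        have e2 := congrArg (Nat.cast : ℕ → ℤ) e1
        push_cast at e2
        rw [card_dim, card_disj, hUF.2, ← hk] at e2
        have : ((Finset.univ.filter fun A : Submodule K V => finrank K A = d ∧ ¬ Disjoint U A).card : ℤ) 
          ≤ (lay F d).card := by linarith
        exact_mod_cast this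
    have hhigh : ∀ B ∈ F, finrank K B ≤ d + 1 := by
      intro B hB
      by_contra! hlt
      obtain ⟨a, rfl⟩ : ∃ a, d = a + 1 := ⟨d - 1, by omega⟩
      obtain ⟨U', hU'B, hU'd, hU'⟩ := exists_sub_ne B U (a+1+1) (by omega) (by omega)
      have h3 := (codeg2 a U' U hU' hU'd hUF.2 (by omega) _ _ rfl rfl).1
      have h4 : (Finset.univ.filter fun A : Submodule K V => finrank K A = a + 1 ∧ Disjoint U' A)
        = (Finset.univ.filter fun A : Submodule K V => finrank K A = a + 1 ∧ (Disjoint U' A ∧ Disjoint U A)) := by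
        refine Finset.filter_congr fun A _ => ?_
        constructor
        · rintro ⟨h5, h6⟩
          refine ⟨h5, h6, ?_⟩
          by_contra h7
          have : A ∈ lay F (a+1) := by
            rw [hlow]; simp only [Finset.mem_filter, Finset.mem_univ, true_and]; exact ⟨h5, h7⟩
          exact not_disj F (a+1) hF B hB U' hU'B hU'd A ((mem_lay _ _ _).1 this).1 h5 h6
        · rintro ⟨h5, h6, _⟩
          exact ⟨h5, h6⟩
      rw [h4, sub_self, zero_mul] at h3
      have hq := q_ge K
      refine absurd h3 (not_le.2 (mul_pos (by linarith) (Finset.prod_pos fun i hi => ?_)))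
      have := Finset.mem_range.1 hi
      have := pow_lt_pow_right₀ (show 1 < (Fintype.card K : ℤ) by linarith) 
        (show a + 3 + i < finrank K V by omega)
      linarith
    have hpeq := (Finset.sum_eq_sum_iff_of_le hp).1 (by linarith)
    have hfull : ∀ A : Submodule K V, finrank K A < d → A ∈ F := by
      intro A hA
      have h3 := hpeq (finrank K A) (Finset.mem_range.2 hA)
      have h4 : lay F (2 * d + 1 - finrank K A) = ∅ := by
        rw [Finset.eq_empty_iff_forall_notMem]
        intro B hB
        rw [mem_lay] at hB
        have := hhigh B hB.1
        omega
      rw [h4, ← card_dim] at h3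
      simp only [Finset.card_empty, Nat.cast_zero, add_zero, Nat.cast_inj] at h3
      have h5 : lay F (finrank K A) = Finset.univ.filter fun B : Submodule K V => finrank K B = finrank K A := by
        refine Finset.eq_of_subset_of_card_le ?_ h3.ge
        intro B hB
        rw [mem_lay] at hB
        simp only [Finset.mem_filter, Finset.mem_univ, true_and]
        exact hB.2
      have : A ∈ lay F (finrank K A) := by rw [h5]; simp
      exact ((mem_lay _ _ _).1 this).1
    refine ⟨U, hUF.2, fun A => ?_⟩
    rcases lt_trichotomy (finrank K A) d with hA | hA | hA
    · exact ⟨fun _ => Or.inl ⟨hA.le, fun h => hA.ne h.1⟩, fun _ => hfull A hA⟩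
    · have h3 : A ∈ lay F d ↔ finrank K A = d ∧ ¬ Disjoint U A := by
        rw [hlow]; simp only [Finset.mem_filter, Finset.mem_univ, true_and]
      rw [mem_lay] at h3
      have h4 : A ≠ U := by rintro rfl; omega
      have := hA.le
      tauto
    · constructor
      · intro h
        have h3 := hhigh A h
        have : A ∈ lay F (d+1) := (mem_lay _ _ _).2 ⟨h, by omega⟩
        rw [hU, Finset.mem_singleton] at this
        exact Or.inr this
      · rintro (h | h)
        · omega
        · rw [h]; exact hUF.1
  · rw [Finset.not_nonempty_iff_eq_empty] at hne
    rw [hne]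
    obtain ⟨B, hB, hBd⟩ := hnK
    obtain ⟨U, hU, hUd⟩ := exists_sub B (d+1) (by omega)
    have := low_le F d hF k hk B hB U hU hUd
    simp only [Finset.card_empty, Nat.cast_zero, add_zero]
    exact ⟨by linarith, fun _ h => by linarith⟩

lemma conv (F : Finset (Submodule K V)) (d : ℕ)
    (hF : ∀ A ∈ F, ∀ B ∈ F, finrank K ↥(A ⊔ B) ≤ 2 * d) (k : ℤ)
    (hk : k = (Fintype.card K : ℤ) ^ (d * (d + 1)) * gbinom (Fintype.card K) (finrank K V - (d + 1)) d)
    (U : Submodule K V) (hU : finrank K U = d + 1) (h : ∀ A, A ∈ F ↔ 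
        (finrank K A ≤ d ∧ ¬ (finrank K A = d ∧ Disjoint U A)) ∨ A = U) :
    (F.card : ℤ) = 
      (∑ i ∈ Finset.range (d + 1), (gbinom (Fintype.card K) (finrank K V) i : ℤ)) - k + 1 := by
  rw [sum_lay F d hF, Finset.sum_range_succ, Finset.sum_range_succ]
  rw [show 2 * d + 1 - d = d + 1 by omega]
  have h1 : ∀ i ∈ Finset.range d, ((lay F i).card : ℤ) + ((lay F (2 * d + 1 - i)).card : ℤ)
      = gbinom (Fintype.card K) (finrank K V) i := by
    intro i hi
    have hi := Finset.mem_range.1 hi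
    have e1 : lay F i = Finset.univ.filter fun B : Submodule K V => finrank K B = i := by
      ext A
      rw [mem_lay, h]
      simp only [Finset.mem_filter, Finset.mem_univ, true_and]
      refine ⟨fun h => h.2, fun h => ⟨Or.inl ⟨by omega, fun h2 => by omega⟩, h⟩⟩
    have e2 : lay F (2 * d + 1 - i) = ∅ := by
      rw [Finset.eq_empty_iff_forall_notMem]
      intro A hA
      rw [mem_lay, h] at hA
      rcases hA with ⟨h1 | rfl, h2⟩ <;> omega
    rw [e1, e2, card_dim]
    simp
  have h2 : lay F (d+1) = {U} := by
    ext A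
    rw [mem_lay, h, Finset.mem_singleton]
    constructor
    · rintro ⟨h1 | h1, h2⟩
      · omega
      · exact h1
    · rintro rfl
      exact ⟨Or.inr rfl, hU⟩
  have h3 : lay F d = Finset.univ.filter fun A : Submodule K V => finrank K A = d ∧ ¬ Disjoint U A := by
    ext A
    rw [mem_lay, h]
    simp only [Finset.mem_filter, Finset.mem_univ, true_and]
    constructor
    · rintro ⟨h1 | rfl, h2⟩
      · exact ⟨h2, fun h3 => h1.2 ⟨h2, h3⟩⟩
      · omega
    · rintro ⟨h1, h2⟩
      exact ⟨Or.inl ⟨h1.le, fun h3 => h2 h3.2⟩, h1⟩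
  have e1 := Finset.card_filter_add_card_filter_not (s := Finset.univ.filter fun A : Submodule K V => finrank K A = d)
    (fun A => Disjoint U A)
  rw [Finset.filter_filter, Finset.filter_filter] at e1
  have e2 := congrArg (Nat.cast : ℕ → ℤ) e1
  push_cast at e2
  rw [card_dim, card_disj, hU, ← hk] at e2
  rw [Finset.sum_congr rfl h1, h2, h3, Finset.card_singleton]
  push_cast
  linarith

end aux4

theorem stmt_7 (q n d : ℕ) (K : Type*) [Field K] [Fintype K] (hK : Fintype.card K = q)
    (V : Type*) [AddCommGroup V] [Module K V] [FiniteDimensional K V]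
    (hV : finrank K V = n) (hs2 : 2 ≤ 2 * d) (hsn : 2 * d < n)
    (F : Set (Submodule K V))
    (hF : ∀ A ∈ F, ∀ B ∈ F, finrank K ↥(A ⊔ B) ≤ 2 * d)
    (hnK : ¬ F ⊆ {A : Submodule K V | finrank K A ≤ d}) :
    (F.ncard : ℤ)
        ≤ (∑ i ∈ Finset.range (d + 1), (gbinom q n i : ℤ))
          - (q : ℤ) ^ (d * (d + 1)) * (gbinom q (n - d - 1) d : ℤ) + 1
    ∧ (2 * d ≤ n - 2 →
        ((F.ncard : ℤ)
            = (∑ i ∈ Finset.range (d + 1), (gbinom q n i : ℤ))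
              - (q : ℤ) ^ (d * (d + 1)) * (gbinom q (n - d - 1) d : ℤ) + 1
          ↔ ∃ U : Submodule K V, finrank K U = d + 1 ∧
              F = ({A : Submodule K V | finrank K A ≤ d}
                    \ {A : Submodule K V | finrank K A = d ∧ A ⊓ U = ⊥}) ∪ {U})) := by
  classical
  subst hK hV
  have : Finite V := Module.finite_of_finite K
  have : Finite (Submodule K V) := inferInstance
  let _ : Fintype V := Fintype.ofFinite V
  let _ : Fintype (Submodule K V) := Fintype.ofFinite _
  have hmem : ∀ A, A ∈ F.toFinset ↔ A ∈ F := fun A => Set.mem_toFinset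
  have hF' : ∀ A ∈ F.toFinset, ∀ B ∈ F.toFinset, finrank K ↥(A ⊔ B) ≤ 2 * d := 
    fun A hA B hB => hF A ((hmem A).1 hA) B ((hmem B).1 hB)
  have hne : ∃ B ∈ F.toFinset, d < finrank K B := by
    rw [Set.not_subset] at hnK
    obtain ⟨B, hB, h⟩ := hnK
    exact ⟨B, (hmem B).2 hB, not_le.1 h⟩
  rw [Nat.sub_sub, Set.ncard_eq_toFinset_card']
  obtain ⟨h1, h2⟩ := bound F.toFinset d (by omega) hsn hF' _ rfl hne
  refine ⟨h1, fun hn => ⟨fun h => ?_, ?_⟩⟩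
  · obtain ⟨U, hU, h3⟩ := h2 (by omega) h
    refine ⟨U, hU, Set.ext fun A => ?_⟩
    rw [← hmem, h3]
    simp only [Set.mem_union, Set.mem_sdiff, Set.mem_ofPred_eq, Set.mem_singleton_iff, disjoint_iff,
      inf_comm U A]
  · rintro ⟨U, hU, h3⟩
    refine conv F.toFinset d hF' _ rfl U hU fun A => ?_
    rw [hmem, h3]
    simp only [Set.mem_union, Set.mem_sdiff, Set.mem_ofPred_eq, Set.mem_singleton_iff, disjoint_iff,
      inf_comm U A]
end
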